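/- There exist constants m and C such that for every integer k ≥ 1 there exist a natural number n ≤ 2k + C·(Nat.log 2 (2k + 1) + 1) and a set G of m matrices in Matrix (Fin n) (Fin n) ℕ with entries in {0, 1}, such that the multiplicative semigroup generated by G is finite and some element of this semigroup has depth at least binom(2k, k) · g(k) with respect to G, where g(k) is the maximum order of a permutation of a k-element set. (This improves Weber's bound of 2^(n−2) for sets of n generating matrices.) -/

import Mathlib

/-- The Landau function: the maximum order of a permutation of a `k`-element set. -/
noncomputable def landau (k : ℕ) : ℕ :=
  Finset.univ.sup fun σ : Equiv.Perm (Fin k) => orderOf σ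

namespace Depth

/-- The letters of the machine. -/
inductive Ltr
  | rd (hold b : Bool)
  | d0 (u : Bool)
  | d1 (u : Bool)
  | rot
  | fin
  | wrap
  deriving DecidableEq, Fintype

/-- The positions of the machine. -/
inductive P (k s : ℕ)
  | main (q : Fin (2 * k))
  | phase (x : Fin 4)
  | mark (m : ZMod s)
  | pend (x : Option Bool)
  | bit (u : Bool) (i : ZMod s) (v : Bool)
  | dum (l : Ltr)

def pEquiv (k s : ℕ) : P k s ≃
    (Fin (2 * k) ⊕ Fin 4 ⊕ ZMod s ⊕ Option Bool ⊕ (Bool × ZMod s × Bool) ⊕ Ltr) where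
  toFun
    | .main q => .inl q
    | .phase x => .inr (.inl x)
    | .mark m => .inr (.inr (.inl m))
    | .pend x => .inr (.inr (.inr (.inl x)))
    | .bit u i v => .inr (.inr (.inr (.inr (.inl (u, i, v)))))
    | .dum l => .inr (.inr (.inr (.inr (.inr l))))
  invFun
    | .inl q => .main q
    | .inr (.inl x) => .phase x
    | .inr (.inr (.inl m)) => .mark m
    | .inr (.inr (.inr (.inl x))) => .pend x
    | .inr (.inr (.inr (.inr (.inl (u, i, v))))) => .bit u i v
    | .inr (.inr (.inr (.inr (.inr l)))) => .dum l
  left_inv x := by cases x <;> rfl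
  right_inv x := by rcases x with x | x | x | x | ⟨u, i, v⟩ | x <;> rfl

noncomputable instance (k s : ℕ) [NeZero s] : Fintype (P k s) := Fintype.ofEquiv _ (pEquiv k s).symm

lemma card_P (k s : ℕ) [NeZero s] :
    Fintype.card (P k s) = 2 * k + 5 * s + 7 + Fintype.card Ltr := by
  rw [Fintype.card_congr (pEquiv k s)]
  simp only [Fintype.card_sum, Fintype.card_prod, Fintype.card_fin, ZMod.card, Fintype.card_bool,
    Fintype.card_option]
  ring

/-! ### Words of partial maps -/

def run {ι X : Type*} (act : ι → X → Option X) : List ι → X → Option X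
  | [], p => some p
  | a :: w, p => (act a p).bind (run act w)

lemma run_append {ι X : Type*} (act : ι → X → Option X) (w w' : List ι) (p : X) :
    run act (w ++ w') p = (run act w p).bind (run act w') := by
  induction w generalizing p with
  | nil => rfl
  | cons a w ih =>
    simp only [List.cons_append, run, Option.bind_assoc]
    congr 1; funext x; exact ih x

open Classical in
noncomputable def toMat {X : Type*} {n : ℕ} (e : X ≃ Fin n) (f : X → Option X) :
    Matrix (Fin n) (Fin n) ℕ :=
  fun p q => if f (e.symm p) = some (e.symm q) then 1 else 0

lemma toMat_inj {X : Type*} {n : ℕ} (e : X ≃ Fin n) : Function.Injective (toMat e) := by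
  intro f g h
  funext p
  apply Option.ext
  intro q
  have := congrFun (congrFun h (e p)) (e q)
  simp only [toMat, Equiv.symm_apply_apply] at this
  split_ifs at this <;> simp_all

open Classical in
lemma toMat_mul {X : Type*} {n : ℕ} (e : X ≃ Fin n) (f g : X → Option X) :
    toMat e f * toMat e g = toMat e (fun p => (f p).bind g) := by
  ext p q
  rw [Matrix.mul_apply]
  cases hf : f (e.symm p) with
  | none => simp [toMat, hf]
  | some r =>
    rw [Finset.sum_eq_single (e r)]
    · have h2 : (f (e.symm p)).bind g = g r := by rw [hf]; rfl
      simp only [toMat]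
      rw [if_pos (by simpa using hf), one_mul]
      exact if_congr (by rw [h2]; simp) rfl rfl
    · intro b _ hb
      have : r ≠ e.symm b := by rintro rfl; simp at hb
      simp [toMat, hf, this]
    · simp

lemma toMat_one {X : Type*} {n : ℕ} (e : X ≃ Fin n) : toMat e some = 1 := by
  ext p q
  simp [toMat, Matrix.one_apply]

lemma toMat_prod {ι X : Type*} {n : ℕ} (e : X ≃ Fin n) (act : ι → X → Option X) (w : List ι) :
    (w.map (fun i => toMat e (act i))).prod = toMat e (run act w) := by
  induction w with
  | nil => exact (toMat_one e).symm
  | cons a w ih => simp only [List.map_cons, List.prod_cons, ih, toMat_mul]; rfl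

lemma lift_word {ι Y : Type*} [Fintype ι] [DecidableEq Y] (f : ι → Y) (w : List Y)
    (h : ∀ X ∈ w, X ∈ Finset.univ.image f) : ∃ v : List ι, v.map f = w := by
  induction w with
  | nil => exact ⟨[], rfl⟩
  | cons a w ih =>
    obtain ⟨v, hv⟩ := ih (fun X hX => h X (List.mem_cons_of_mem _ hX))
    obtain ⟨i, _, hi⟩ := Finset.mem_image.1 (h a (by simp))
    exact ⟨i :: v, by simp [hv, hi]⟩

/-- Reduction of the matrix statement to a statement about partial maps. -/
lemma framework {ι X : Type} [Fintype ι] [Fintype X] (act : ι → X → Option X)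
    (hact : Function.Injective act) (D : ℕ) (w0 : List ι) (hw0 : w0 ≠ [])
    (hD : ∀ w : List ι, w ≠ [] → run act w = run act w0 → D ≤ w.length) :
    ∃ G : Finset (Matrix (Fin (Fintype.card X)) (Fin (Fintype.card X)) ℕ),
      G.card = Fintype.card ι ∧
      (∀ M ∈ G, ∀ p q, M p q = 0 ∨ M p q = 1) ∧
      {M : Matrix (Fin (Fintype.card X)) (Fin (Fintype.card X)) ℕ |
        ∃ w : List (Matrix (Fin (Fintype.card X)) (Fin (Fintype.card X)) ℕ),
          w ≠ [] ∧ (∀ X ∈ w, X ∈ G) ∧ w.prod = M}.Finite ∧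
      ∃ M : Matrix (Fin (Fintype.card X)) (Fin (Fintype.card X)) ℕ,
        (∃ w : List (Matrix (Fin (Fintype.card X)) (Fin (Fintype.card X)) ℕ),
          w ≠ [] ∧ (∀ X ∈ w, X ∈ G) ∧ w.prod = M) ∧
        (∀ w : List (Matrix (Fin (Fintype.card X)) (Fin (Fintype.card X)) ℕ),
          w ≠ [] → (∀ X ∈ w, X ∈ G) → w.prod = M → D ≤ w.length) := by
  classical
  let e := Fintype.equivFin X
  refine ⟨Finset.univ.image (fun i => toMat e (act i)), ?_, ?_, ?_, toMat e (run act w0), ?_, ?_⟩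
  · exact (Finset.card_image_of_injective _ ((toMat_inj e).comp hact)).trans Finset.card_univ
  · intro M hM p q
    obtain ⟨i, _, rfl⟩ := Finset.mem_image.1 hM
    simp only [toMat]
    split_ifs <;> simp
  · apply (Set.finite_range (toMat e)).subset
    rintro M ⟨w, _, hw, rfl⟩
    obtain ⟨v, rfl⟩ := lift_word _ w hw
    exact ⟨_, (toMat_prod e act v).symm⟩
  · refine ⟨w0.map (fun i => toMat e (act i)), by simpa using hw0, ?_, toMat_prod e act w0⟩
    intro Y hY
    obtain ⟨i, _, rfl⟩ := List.mem_map.1 hY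
    exact Finset.mem_image_of_mem _ (Finset.mem_univ _)
  · intro w hne hw hp
    obtain ⟨v, rfl⟩ := lift_word _ w hw
    rw [toMat_prod] at hp
    have := hD v (by simpa using hne) (toMat_inj e hp)
    simpa using this

/-! ### The rank function of the cool-lex order -/

/-- `1^t 0^s`, read backwards. -/
def Srt (r : List Bool) : Prop := ∃ a c, r = List.replicate c false ++ List.replicate a true

open Classical in
/-- Rank of a reversed bit string. -/
noncomputable def R : List Bool → ℕ
  | [] => 0
  | b :: r => if Srt (b :: r) then 0 else
      if b then 1 + R r else Nat.choose r.length ((b :: r).count false) + R r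

lemma R_srt {r : List Bool} (h : Srt r) : R r = 0 := by
  cases r with
  | nil => rfl
  | cons b r => simp [R, h]

lemma srt_of_cons {b : Bool} {r : List Bool} (h : Srt (b :: r)) : Srt r := by
  obtain ⟨a, c, h⟩ := h
  cases c with
  | zero =>
    cases a with
    | zero => simp at h
    | succ a =>
      simp [List.replicate_succ] at h
      exact ⟨a, 0, by simp [h.2]⟩
  | succ c =>
    simp [List.replicate_succ] at h
    exact ⟨a, c, h.2⟩

lemma R_lt (r : List Bool) : R r < Nat.choose r.length (r.count false) := by
  induction r with
  | nil => simp [R]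
  | cons b r ih =>
    have hle : r.count false ≤ r.length := List.count_le_length
    by_cases hs : Srt (b :: r)
    · rw [R_srt hs]
      exact Nat.choose_pos List.count_le_length
    · cases b with
      | true =>
        have h1 : R (true :: r) = 1 + R r := by simp [R, hs]
        have hpos : 0 < r.count false := by
          rw [List.count_pos_iff]
          by_contra hn
          apply hs
          refine ⟨r.length + 1, 0, ?_⟩
          simp only [List.replicate_zero, List.nil_append, List.replicate_succ, List.cons.injEq,
            true_and]
          rw [List.eq_replicate_iff]
          refine ⟨rfl, fun b hb => ?_⟩
          cases b
          · exact absurd hb hn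
          · rfl
        obtain ⟨m, hm⟩ : ∃ m, r.count false = m + 1 := ⟨r.count false - 1, by omega⟩
        have h2 : (true :: r).count false = m + 1 := by simp [hm]
        rw [h1, h2, List.length_cons, Nat.choose_succ_succ]
        have : 0 < r.length.choose m := Nat.choose_pos (by omega)
        rw [hm] at ih
        simp only [Nat.succ_eq_add_one]
        omega
      | false =>
        have h1 : R (false :: r) = r.length.choose ((false :: r).count false) + R r := by
          simp [R, hs]
        rw [h1, List.count_cons_self, List.length_cons, Nat.choose_succ_succ]
        simp only [Nat.succ_eq_add_one]
        omega

lemma not_srt (r q : List Bool) (b : ℕ) : ¬ Srt (q ++ true :: (List.replicate (b+1) false ++ r)) := by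
  intro h
  induction q with
  | nil =>
    obtain ⟨a, c, h⟩ := h
    cases c with
    | zero =>
      cases a with
      | zero => simp at h
      | succ a =>
        simp [List.replicate_succ] at h
        cases a with
        | zero => simp at h
        | succ a => simp [List.replicate_succ] at h
    | succ c => simp [List.replicate_succ] at h
  | cons x q ih => exact ih (srt_of_cons h)

/-- the last string -/
lemma R_last (a c : ℕ) :
    R (List.replicate c false ++ (List.replicate a true ++ [false])) + 1 =
      Nat.choose (a + c + 1) (c + 1) := by
  rcases Nat.eq_zero_or_pos a with rfl | ha
  · rw [R_srt ⟨0, c+1, by simp [List.replicate_succ']⟩]; simp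
  obtain ⟨a, rfl⟩ : ∃ a', a = a' + 1 := ⟨a - 1, by omega⟩
  have hns : ∀ q a, ¬ Srt (q ++ (List.replicate (a+1) true ++ [false])) := by
    intro q a h
    apply not_srt [] (q ++ List.replicate a true) 0
    simpa [List.replicate_succ'] using h
  induction c with
  | zero =>
    simp only [List.replicate_zero, List.nil_append]
    have : ∀ a, R (List.replicate a true ++ [false]) = a := by
      intro a
      induction a with
      | zero => exact R_srt ⟨0, 1, rfl⟩
      | succ a ih =>
        have := hns [] a
        simp only [List.nil_append, List.replicate_succ, List.cons_append] at this ⊢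
        simp only [R, this, if_false, if_true, ih]
        omega
    rw [this]; simp
  | succ c ih =>
    have := hns (List.replicate (c+1) false) a
    simp only [List.replicate_succ, List.cons_append] at this ih ⊢
    rw [R, if_neg this, Nat.choose_succ_succ]
    simp only [Bool.false_eq_true, if_false]
    have e1 : (List.replicate c false ++ true :: (List.replicate a true ++ [false])).length
      = a + 1 + c + 1 := by simp; omega
    have e2 : (false :: (List.replicate c false ++ true :: (List.replicate a true ++ [false]))).count false
      = c + 1 + 1 := by simp [List.count_replicate]
    rw [e1, e2]
    have e3 : a + 1 + (c + 1) = a + 1 + c + 1 := by ring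
    rw [e3]
    simp only [Nat.succ_eq_add_one]
    omega

/-- The moving block, as bits. -/
def Pre (a b : ℕ) : List Bool := List.replicate a true ++ (List.replicate (b+1) false ++ [true])

lemma Pre_rev (a b : ℕ) : (Pre a b).reverse = true :: (List.replicate (b+1) false ++ List.replicate a true) := by
  simp [Pre]

lemma R_move (x : Bool) (a b : ℕ) (q : List Bool) :
    R (q ++ (x :: (Pre a b).reverse)) = R (q ++ ((Pre a b).reverse ++ [x])) + 1 := by
  rw [Pre_rev]
  have n1 : ∀ q, ¬ Srt (q ++ (x :: true :: (List.replicate (b+1) false ++ List.replicate a true))) := by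
    intro q
    have := not_srt (List.replicate a true) (q ++ [x]) b
    simpa using this
  have n2 : ∀ q, ¬ Srt (q ++ (true :: (List.replicate (b+1) false ++ List.replicate a true) ++ [x])) := by
    intro q
    have := not_srt (List.replicate a true ++ [x]) q b
    simpa using this
  have n3 := not_srt (List.replicate a true) [] b
  simp only [List.nil_append] at n3
  induction q with
  | nil =>
    have m1 := n1 []
    have m2 := n2 []
    simp only [List.nil_append, List.cons_append] at m1 m2 ⊢
    have r3 : R (true :: (List.replicate (b+1) false ++ List.replicate a true)) = 1 := by
      rw [R, if_neg n3, R_srt ⟨a, b+1, rfl⟩]; rfl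
    cases x with
    | true =>
      rw [R, if_neg m1, r3, R, if_neg m2, R_srt ⟨a+1, b+1, by simp [List.replicate_succ']⟩]
      rfl
    | false =>
      rw [R, if_neg m1, r3, R, if_neg m2]
      have := R_last a (b+1)
      simp only [List.append_assoc, if_true, Bool.false_eq_true, if_false] at *
      have e1 : (true :: (List.replicate (b+1) false ++ List.replicate a true)).length = a + (b+1) + 1 := by
        simp; omega
      have e2 : (false :: true :: (List.replicate (b+1) false ++ List.replicate a true)).count false = b + 1 + 1 := by
        simp [List.count_replicate]
      rw [e1, e2]
      omega
  | cons y q ih =>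
    have m1 := n1 (y :: q)
    have m2 := n2 (y :: q)
    simp only [List.cons_append] at m1 m2 ih ⊢
    rw [R, if_neg m1, R, if_neg m2, ih]
    cases y
    · simp only [Bool.false_eq_true, if_false]
      have e1 : (q ++ x :: true :: (List.replicate (b + 1) false ++ List.replicate a true)).length
        = (q ++ true :: (List.replicate (b + 1) false ++ List.replicate a true ++ [x])).length := by
          simp; omega
      have e2 : (false :: (q ++ x :: true :: (List.replicate (b + 1) false ++ List.replicate a true))).count false
        = (false :: (q ++ true :: (List.replicate (b + 1) false ++ List.replicate a true ++ [x]))).count false := by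
          apply List.Perm.count_eq
          apply List.Perm.cons
          apply List.Perm.append_left
          refine (List.Perm.swap _ _ _).trans (List.Perm.cons _ ?_)
          exact List.perm_append_comm (l₁ := [x])
      rw [e1, e2]; omega
    · simp only [if_true]; omega

/-- Either a list has a moving block or it is sorted -/
lemma split_bits (l : List Bool) : (∃ a c, l = List.replicate a true ++ List.replicate c false) ∨
    ∃ a b q, l = Pre a b ++ q := by
  induction l with
  | nil => exact .inl ⟨0, 0, rfl⟩
  | cons x l ih =>
    rcases ih with ⟨a, c, rfl⟩ | ⟨a, b, q, rfl⟩
    · cases x with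
      | true => exact .inl ⟨a+1, c, rfl⟩
      | false =>
        cases a with
        | zero => exact .inl ⟨0, c+1, rfl⟩
        | succ a => exact .inr ⟨0, 0, List.replicate a true ++ List.replicate c false, by simp [Pre, List.replicate_succ]⟩
    · right
      cases x with
      | true => exact ⟨a+1, b, q, rfl⟩
      | false =>
        cases a with
        | zero => exact ⟨0, b+1, q, rfl⟩
        | succ a => exact ⟨0, 0, List.replicate a true ++ (List.replicate (b+1) false ++ [true]) ++ q, by simp [Pre, List.replicate_succ]⟩

lemma exists_move (l : List Bool) (h0 : 0 < R l.reverse)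
    (h1 : R l.reverse + 1 < Nat.choose l.length (l.count false)) :
    ∃ x a b q, l = x :: (Pre a b ++ q) := by
  cases l with
  | nil => simp [R] at h0
  | cons x l =>
    rcases split_bits l with ⟨a, c, rfl⟩ | ⟨a, b, q, rfl⟩
    · exfalso
      cases x with
      | true =>
        rw [R_srt ⟨a+1, c, by simp [List.replicate_succ']⟩] at h0
        omega
      | false =>
        have := R_last a c
        have e : (false :: (List.replicate a true ++ List.replicate c false)).reverse =
          List.replicate c false ++ (List.replicate a true ++ [false]) := by simp
        rw [e, this] at h1
        have e2 : (false :: (List.replicate a true ++ List.replicate c false)).count false = c + 1 := by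
          simp [List.count_replicate]
        rw [e2] at h1
        simp at h1
    · exact ⟨x, a, b, q, rfl⟩

lemma Pre_unique {a b a' b' : ℕ} {q q' : List Bool} (h : Pre a b ++ q = Pre a' b' ++ q') :
    a = a' ∧ b = b' := by
  have hf : ∀ b b' (q q' : List Bool), List.replicate b false ++ true :: q = List.replicate b' false ++ true :: q' → b = b' := by
    intro b
    induction b with
    | zero => intro b'; cases b' <;> simp [List.replicate_succ]
    | succ b ih => intro b'; cases b' <;> simp [List.replicate_succ]; exact ih _
  induction a generalizing a' with
  | zero =>
    cases a' with
    | zero =>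
      simp only [Pre, List.replicate_zero, List.nil_append, List.append_assoc, List.cons_append] at h
      have := hf _ _ _ _ h
      exact ⟨rfl, by omega⟩
    | succ a' => simp [Pre, List.replicate_succ] at h
  | succ a ih =>
    cases a' with
    | zero => simp [Pre, List.replicate_succ] at h
    | succ a' =>
      have := @ih a' (by simpa [Pre, List.replicate_succ] using h)
      exact ⟨by omega, this.2⟩

end Depth

namespace Depth

/-! ### The machine -/

def nrm {k : ℕ} (q : Fin (2 * k)) : Fin (2 * k) :=
  ⟨if q.val = 0 then 2 * k - 1 else q.val - 1, by have := q.2; split_ifs <;> omega⟩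

def hld {k : ℕ} (q : Fin (2 * k)) : Fin (2 * k) :=
  ⟨if q.val = 0 then 0 else if q.val = 1 then 2 * k - 1 else q.val - 1, by
    have := q.2; split_ifs <;> omega⟩

def phs (hold b : Bool) (x : Fin 4) : Option (Fin 4) :=
  if hold then
    (if b then (if x = 0 then some 0 else if x = 1 then some 2 else none)
      else (if x = 0 ∨ x = 1 then some 1 else none))
  else (if x = 2 ∨ x = 3 then some 3 else none)

def mvm {k : ℕ} (hold : Bool) (q : Fin (2 * k)) : Fin (2 * k) := if hold then hld q else nrm q

def act {k s : ℕ} (K : ZMod s → Bool) (Wm : Fin (2 * k) → Option (Fin (2 * k))) :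
    Ltr → P k s → Option (P k s)
  | .rd hold b, .main q => if b = false ∧ q.val = hold.toNat then none else some (.main (mvm hold q))
  | .rd hold b, .phase x => (phs hold b x).map .phase
  | .rd _ _, .mark m => if m = 0 then some (.mark m) else none
  | .rd _ b, .pend x => if x = none then some (.pend (some b)) else none
  | .rd _ _, .bit u i v => some (.bit u i v)
  | .d0 _, .main q => some (.main q)
  | .d0 _, .phase x => some (.phase x)
  | .d0 _, .mark m => some (.mark (m - 1))
  | .d0 u, .pend x => if x = some u then some (.pend none) else none
  | .d0 u, .bit u' i v => if u' = u ∧ i = 0 then (if v then some (.bit u' (i - 1) false) else none)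
      else some (.bit u' (i - 1) v)
  | .d1 _, .main q => some (.main q)
  | .d1 _, .phase x => some (.phase x)
  | .d1 _, .mark m => if m = 1 then none else some (.mark (m - 1))
  | .d1 u, .pend x => if x = some u then some (.pend x) else none
  | .d1 u, .bit u' i v => if u' = u ∧ i = 0 then (if v then none else some (.bit u' (i - 1) true))
      else some (.bit u' (i - 1) v)
  | .rot, .main q => some (.main q)
  | .rot, .phase x => some (.phase x)
  | .rot, .mark m => some (.mark (m - 1))
  | .rot, .pend x => if x = none then some (.pend none) else none
  | .rot, .bit u i v => some (.bit u (i - 1) v)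
  | .fin, .main q => some (.main q)
  | .fin, .phase x => if x = 3 then some (.phase 0) else none
  | .fin, .mark m => if m = 0 then some (.mark m) else none
  | .fin, .pend x => if x = none then some (.pend none) else none
  | .fin, .bit u i v => if v then none else some (.bit u i (K i))
  | .wrap, .main q => (Wm q).map .main
  | .wrap, .phase x => if x = 0 then some (.phase 0) else none
  | .wrap, .mark m => if m = 0 then some (.mark m) else none
  | .wrap, .pend x => if x = none then some (.pend none) else none
  | .wrap, .bit u i v => if v = K i then some (.bit u i v) else none
  | l, .dum l' => if l' = l then some (.dum l') else none

lemma act_dum {k s : ℕ} (K : ZMod s → Bool) (Wm : Fin (2 * k) → Option (Fin (2 * k))) (l l' : Ltr) :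
    act K Wm l (.dum l') = if l' = l then some (.dum l') else none := by
  cases l <;> rfl

lemma act_inj {k s : ℕ} (K : ZMod s → Bool) (Wm : Fin (2 * k) → Option (Fin (2 * k))) :
    Function.Injective (act K Wm) := by
  intro l l' h
  have := congrFun h (.dum l)
  rw [act_dum, act_dum] at this
  by_contra hne
  simp [hne] at this

inductive Tok (k s : ℕ)
  | main (t : Fin k)
  | phase
  | mark
  | pend
  | bit (u : Bool) (j : ZMod s)

@[ext]
structure St (k s : ℕ) where
  c : Fin k → Fin (2 * k)
  ph : Fin 4
  h : ZMod s
  pd : Option Bool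
  β : Bool → ZMod s → Bool

def St.pos {k s : ℕ} (S : St k s) : Tok k s → P k s
  | .main t => .main (S.c t)
  | .phase => .phase S.ph
  | .mark => .mark (- S.h)
  | .pend => .pend S.pd
  | .bit u j => .bit u (j - S.h) (S.β u j)

lemma pos_inj {k s : ℕ} {S S' : St k s} (h : ∀ t, S.pos t = S'.pos t) : S = S' := by
  have h1 := h .phase
  have h2 := h .mark
  have h3 := h .pend
  simp only [St.pos, P.phase.injEq, P.mark.injEq, P.pend.injEq, neg_inj] at h1 h2 h3
  ext1
  · funext t; simpa [St.pos] using h (.main t)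
  · exact h1
  · exact h2
  · exact h3
  · funext u j
    have := h (.bit u j)
    simp only [St.pos, P.bit.injEq] at this
    exact this.2.2

section
variable {k s : ℕ} (K : ZMod s → Bool) (Wm : Fin (2 * k) → Option (Fin (2 * k)))

def Step (l : Ltr) (S S' : St k s) : Prop := ∀ t, act K Wm l (S.pos t) = some (S'.pos t)

def Alive (l : Ltr) (S : St k s) : Prop := ∀ t, ∃ q, act K Wm l (S.pos t) = some q

lemma step_rd {S : St k s} {hold b : Bool} {ph' : Fin 4} (h1 : S.pd = none) (h2 : S.h = 0)
    (h3 : phs hold b S.ph = some ph') (h4 : b = false → ∀ t, (S.c t).val ≠ hold.toNat) :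
    Step K Wm (.rd hold b) S { S with c := fun t => mvm hold (S.c t), ph := ph', pd := some b } := by
  intro t
  cases t with
  | main t =>
    simp only [St.pos, act]
    rw [if_neg]
    rintro ⟨hb, hq⟩
    exact h4 hb t hq
  | phase => simp [St.pos, act, h3]
  | mark => simp [St.pos, act, h2]
  | pend => simp [St.pos, act, h1]
  | bit u j => simp [St.pos, act]

lemma alive_rd {S : St k s} {hold b : Bool} (H : Alive K Wm (.rd hold b) S) :
    S.pd = none ∧ S.h = 0 ∧ (∃ ph', phs hold b S.ph = some ph') ∧
      (b = false → ∀ t, (S.c t).val ≠ hold.toNat) := by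
  refine ⟨?_, ?_, ?_, ?_⟩
  · obtain ⟨q, hq⟩ := H .pend
    by_contra hn
    simp [St.pos, act, hn] at hq
  · obtain ⟨q, hq⟩ := H .mark
    by_contra hn
    simp [St.pos, act, hn] at hq
  · obtain ⟨q, hq⟩ := H .phase
    simp only [St.pos, act, Option.map_eq_some_iff] at hq
    obtain ⟨a, ha, _⟩ := hq
    exact ⟨a, ha⟩
  · intro hb t ht
    obtain ⟨q, hq⟩ := H (.main t)
    simp [St.pos, act, hb, ht] at hq

lemma step_d0 {S : St k s} {u : Bool} (h1 : S.pd = some u) (h2 : S.β u S.h = true) :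
    Step K Wm (.d0 u) S { S with
      h := S.h + 1, pd := none, β := Function.update S.β u (Function.update (S.β u) S.h false) } := by
  intro t
  cases t with
  | main t => rfl
  | phase => rfl
  | mark => simp only [St.pos, act]; congr 2; ring
  | pend => simp [St.pos, act, h1]
  | bit u' j =>
    simp only [St.pos, act]
    by_cases hu : u' = u
    · subst hu
      by_cases hj : j = S.h
      · subst hj; simp [h2]
      · have : ¬ (j - S.h = 0) := by rwa [sub_eq_zero]
        simp [this, hj]; ring
    · simp [hu]; ring

lemma alive_d0 {S : St k s} {u : Bool} (H : Alive K Wm (.d0 u) S) :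
    S.pd = some u ∧ S.β u S.h = true := by
  refine ⟨?_, ?_⟩
  · obtain ⟨q, hq⟩ := H .pend
    by_contra hn
    simp [St.pos, act, hn] at hq
  · obtain ⟨q, hq⟩ := H (.bit u S.h)
    by_contra hn
    simp [St.pos, act, hn] at hq

lemma step_d1 {S : St k s} {u : Bool} (h1 : S.pd = some u) (h2 : S.β u S.h = false)
    (h3 : S.h + 1 ≠ 0) :
    Step K Wm (.d1 u) S { S with
      h := S.h + 1, β := Function.update S.β u (Function.update (S.β u) S.h true) } := by
  intro t
  cases t with
  | main t => rfl
  | phase => rfl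
  | mark =>
    simp only [St.pos, act]
    rw [if_neg]
    · congr 2; ring
    · intro h; apply h3; rw [← h]; ring
  | pend => simp [St.pos, act, h1]
  | bit u' j =>
    simp only [St.pos, act]
    by_cases hu : u' = u
    · subst hu
      by_cases hj : j = S.h
      · subst hj; simp [h2]
      · have : ¬ (j - S.h = 0) := by rwa [sub_eq_zero]
        simp [this, hj]; ring
    · simp [hu]; ring

lemma alive_d1 {S : St k s} {u : Bool} (H : Alive K Wm (.d1 u) S) :
    S.pd = some u ∧ S.β u S.h = false ∧ S.h + 1 ≠ 0 := by
  refine ⟨?_, ?_, ?_⟩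
  · obtain ⟨q, hq⟩ := H .pend
    by_contra hn
    simp [St.pos, act, hn] at hq
  · obtain ⟨q, hq⟩ := H (.bit u S.h)
    by_contra hn
    simp [St.pos, act, hn] at hq
  · obtain ⟨q, hq⟩ := H .mark
    intro hn
    have : - S.h = 1 := by rw [neg_eq_iff_add_eq_zero]; exact hn
    simp [St.pos, act, this] at hq

lemma step_rot {S : St k s} (h1 : S.pd = none) : Step K Wm .rot S { S with h := S.h + 1 } := by
  intro t
  cases t with
  | main t => rfl
  | phase => rfl
  | mark => simp only [St.pos, act]; congr 2; ring
  | pend => simp [St.pos, act, h1]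
  | bit u' j => simp only [St.pos, act]; congr 2; ring

lemma alive_rot {S : St k s} (H : Alive K Wm .rot S) : S.pd = none := by
  obtain ⟨q, hq⟩ := H .pend
  by_contra hn
  simp [St.pos, act, hn] at hq

lemma step_fin {S : St k s} (h1 : S.pd = none) (h2 : S.h = 0) (h3 : S.ph = 3)
    (h4 : ∀ u j, S.β u j = false) :
    Step K Wm .fin S { S with ph := 0, β := fun _ j => K j } := by
  intro t
  cases t with
  | main t => rfl
  | phase => simp [St.pos, act, h3]
  | mark => simp [St.pos, act, h2]
  | pend => simp [St.pos, act, h1]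
  | bit u' j => simp [St.pos, act, h2, h4]

lemma alive_fin {S : St k s} (H : Alive K Wm .fin S) :
    S.pd = none ∧ S.h = 0 ∧ S.ph = 3 ∧ ∀ u j, S.β u j = false := by
  refine ⟨?_, ?_, ?_, ?_⟩
  · obtain ⟨q, hq⟩ := H .pend
    by_contra hn
    simp [St.pos, act, hn] at hq
  · obtain ⟨q, hq⟩ := H .mark
    by_contra hn
    simp [St.pos, act, hn] at hq
  · obtain ⟨q, hq⟩ := H .phase
    by_contra hn
    simp [St.pos, act, hn] at hq
  · intro u j
    obtain ⟨q, hq⟩ := H (.bit u j)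
    by_contra hn
    simp [St.pos, act, hn] at hq

lemma step_wrap {S : St k s} {c' : Fin k → Fin (2 * k)} (h1 : S.pd = none) (h2 : S.h = 0)
    (h3 : S.ph = 0) (h4 : ∀ u j, S.β u j = K j) (h5 : ∀ t, Wm (S.c t) = some (c' t)) :
    Step K Wm .wrap S { S with c := c' } := by
  intro t
  cases t with
  | main t => simp [St.pos, act, h5]
  | phase => simp [St.pos, act, h3]
  | mark => simp [St.pos, act, h2]
  | pend => simp [St.pos, act, h1]
  | bit u' j => simp [St.pos, act, h2, h4]

lemma alive_wrap {S : St k s} (H : Alive K Wm .wrap S) :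
    S.pd = none ∧ S.h = 0 ∧ S.ph = 0 ∧ (∀ u j, S.β u j = K j) ∧
      ∀ t, ∃ q, Wm (S.c t) = some q := by
  have h0 : S.h = 0 := by
    obtain ⟨q, hq⟩ := H .mark
    by_contra hn
    simp [St.pos, act, hn] at hq
  refine ⟨?_, h0, ?_, ?_, ?_⟩
  · obtain ⟨q, hq⟩ := H .pend
    by_contra hn
    simp [St.pos, act, hn] at hq
  · obtain ⟨q, hq⟩ := H .phase
    by_contra hn
    simp [St.pos, act, hn] at hq
  · intro u j
    obtain ⟨q, hq⟩ := H (.bit u j)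
    by_contra hn
    simp [St.pos, act, h0, hn] at hq
  · intro t
    obtain ⟨q, hq⟩ := H (.main t)
    simp only [St.pos, act, Option.map_eq_some_iff] at hq
    obtain ⟨a, ha, _⟩ := hq
    exact ⟨a, ha⟩

/-! ### Counter values -/

def bv (β : ZMod s → Bool) [NeZero s] : ℤ := ∑ j, if β j then 2 ^ j.val else 0

def pv (h : ZMod s) (pd : Option Bool) (u : Bool) : ℤ := if pd = some u then 2 ^ h.val else 0

def St.val [NeZero s] (S : St k s) (u : Bool) : ℤ := bv (S.β u) - pv S.h S.pd u

lemma bv_update [NeZero s] (β : ZMod s → Bool) (h : ZMod s) (v : Bool) :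
    bv (Function.update β h v) = bv β + (if v then 2 ^ h.val else 0) - (if β h then 2 ^ h.val else 0) := by
  unfold bv
  rw [← Finset.add_sum_erase _ _ (Finset.mem_univ h), ← Finset.add_sum_erase (a := h) _ (fun j => if β j then (2:ℤ) ^ j.val else 0) (Finset.mem_univ h)]
  have : ∀ j ∈ Finset.univ.erase h, (if Function.update β h v j then (2:ℤ) ^ j.val else 0) = if β j then (2:ℤ) ^ j.val else 0 := by
    intro j hj
    rw [Function.update_of_ne (Finset.ne_of_mem_erase hj)]
  rw [Finset.sum_congr rfl this]
  simp
  ring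

lemma val_succ [NeZero s] {h : ZMod s} (h1 : h + 1 ≠ 0) : (h + 1).val = h.val + 1 := by
  have hs : s ≠ 1 := by rintro rfl; exact h1 (Subsingleton.elim _ _)
  have : Fact (1 < s) := ⟨by have := NeZero.ne s; omega⟩
  suffices hh : h.val + 1 < s by
    rw [ZMod.val_add_of_lt (by rwa [ZMod.val_one s]), ZMod.val_one s]
  by_contra hn
  have hlt := ZMod.val_lt h
  apply h1
  have : h.val = s - 1 := by omega
  have e : h = ((s - 1 : ℕ) : ZMod s) := by rw [← this, ZMod.natCast_zmod_val]
  rw [e]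
  have : ((s - 1 + 1 : ℕ) : ZMod s) = 0 := by
    rw [Nat.sub_add_cancel (Nat.one_le_iff_ne_zero.2 (NeZero.ne s))]; simp
  simpa using this

end
end Depth

namespace Depth
section
variable {k s : ℕ}

lemma val_rd [NeZero s] {S : St k s} {b : Bool} (h1 : S.pd = none) (h2 : S.h = 0)
    (c' : Fin k → Fin (2 * k)) (ph' : Fin 4) (u : Bool) :
    St.val { S with c := c', ph := ph', pd := some b } u = S.val u - if b = u then 1 else 0 := by
  simp [St.val, pv, h1, h2]

lemma val_d0 [NeZero s] {S : St k s} {v : Bool} (h1 : S.pd = some v) (h2 : S.β v S.h = true) (u : Bool) :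
    St.val { S with
      h := S.h + 1, pd := none, β := Function.update S.β v (Function.update (S.β v) S.h false) } u
      = S.val u := by
  by_cases hu : u = v
  · subst hu; simp [St.val, pv, h1, bv_update, h2]
  · have : ¬ (v = u) := fun h => hu h.symm
    simp [St.val, pv, h1, hu, this]

lemma val_d1 [NeZero s] {S : St k s} {v : Bool} (h1 : S.pd = some v) (h2 : S.β v S.h = false)
    (h3 : S.h + 1 ≠ 0) (u : Bool) :
    St.val { S with
      h := S.h + 1, β := Function.update S.β v (Function.update (S.β v) S.h true) } u
      = S.val u := by
  by_cases hu : u = v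
  · subst hu; simp [St.val, pv, h1, bv_update, h2, val_succ h3]; ring
  · have : ¬ (v = u) := fun h => hu h.symm
    simp [St.val, pv, h1, hu, this]

lemma val_rot [NeZero s] {S : St k s} (h1 : S.pd = none) (u : Bool) :
    St.val { S with h := S.h + 1 } u = S.val u := by
  simp [St.val, pv, h1]

lemma sum_testBit (n k : ℕ) :
    ∑ i ∈ Finset.range n, (if k.testBit i then 2 ^ i else 0 : ℕ) = k % 2 ^ n := by
  induction n with
  | zero => simp [Nat.mod_one]
  | succ n ih =>
    rw [Finset.sum_range_succ, ih, pow_succ, Nat.mod_mul, Nat.testBit_eq_decide_div_mod_eq]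
    congr 1
    rcases Nat.mod_two_eq_zero_or_one (k / 2 ^ n) with h | h <;> simp [h]

lemma bv_K [NeZero s] (h : k < 2 ^ s) : bv (fun j : ZMod s => k.testBit j.val) = k := by
  have : bv (fun j : ZMod s => k.testBit j.val) =
      ((∑ i ∈ Finset.range s, (if k.testBit i then 2 ^ i else 0 : ℕ) : ℕ) : ℤ) := by
    unfold bv
    obtain ⟨n, rfl⟩ : ∃ n, s = n + 1 := ⟨s - 1, by have := NeZero.ne s; omega⟩
    rw [← Fin.sum_univ_eq_sum_range (fun i => (if k.testBit i then 2 ^ i else 0 : ℕ))]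
    push_cast
    rfl
  rw [this, sum_testBit, Nat.mod_eq_of_lt h]

lemma bv_nonneg [NeZero s] (β : ZMod s → Bool) : 0 ≤ bv β :=
  Finset.sum_nonneg fun j _ => by split_ifs <;> positivity

lemma bv_zero [NeZero s] {β : ZMod s → Bool} (h : bv β = 0) (j : ZMod s) : β j = false := by
  unfold bv at h
  rw [Finset.sum_eq_zero_iff_of_nonneg (fun j _ => by split_ifs <;> positivity)] at h
  have := h j (Finset.mem_univ _)
  by_contra hn
  simp [hn] at this

/-! ### Token arrangements as lists -/

def Rep (c : Fin k → Fin (2 * k)) (l : List (Option (Fin k))) : Prop :=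
  l.length = 2 * k ∧ ∀ t q, l[q]? = some (some t) ↔ (c t).val = q

lemma rep_nrm {c : Fin k → Fin (2 * k)} {x : Option (Fin k)} {r : List (Option (Fin k))}
    (h : Rep c (x :: r)) : Rep (fun t => nrm (c t)) (r ++ [x]) := by
  obtain ⟨h1, h2⟩ := h
  refine ⟨by simpa using h1, fun t q => ?_⟩
  have hc := (c t).2
  simp only [List.length_cons] at h1
  simp only [nrm]
  rcases lt_trichotomy q r.length with hq | hq | hq
  · rw [List.getElem?_append_left hq]
    have := h2 t (q + 1)
    rw [List.getElem?_cons_succ] at this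
    rw [this]
    split_ifs <;> omega
  · have := h2 t 0
    subst hq
    simp at this ⊢
    rw [this]
    split_ifs <;> omega
  · rw [List.getElem?_eq_none (by simp; omega)]
    simp
    split_ifs <;> omega

lemma rep_hld {c : Fin k → Fin (2 * k)} {x e : Option (Fin k)} {r : List (Option (Fin k))}
    (h : Rep c (x :: e :: r)) : Rep (fun t => hld (c t)) (x :: (r ++ [e])) := by
  obtain ⟨h1, h2⟩ := h
  refine ⟨by simpa using h1, fun t q => ?_⟩
  have hc := (c t).2
  simp only [List.length_cons] at h1
  have hh : ((c t).val = 0 ∧ (hld (c t)).val = 0) ∨ ((c t).val = 1 ∧ (hld (c t)).val = 2 * k - 1) ∨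
      (2 ≤ (c t).val ∧ (hld (c t)).val = (c t).val - 1) := by
    by_cases e0 : (c t).val = 0
    · left; simp [hld, e0]
    · by_cases e1 : (c t).val = 1
      · right; left; simp [hld, e1]
      · right; right; exact ⟨by omega, by simp [hld, e0, e1]⟩
  show _ ↔ (hld (c t)).val = q
  cases q with
  | zero =>
    have := h2 t 0
    simp at this ⊢
    rw [this]
    omega
  | succ q =>
    rw [List.getElem?_cons_succ]
    rcases lt_trichotomy q r.length with hq | hq | hq
    · rw [List.getElem?_append_left hq]
      have := h2 t (q + 2)
      rw [List.getElem?_cons_succ, List.getElem?_cons_succ] at this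
      rw [this]
      omega
    · have := h2 t 1
      subst hq
      simp at this ⊢
      rw [this]
      omega
    · rw [List.getElem?_eq_none (by simp; omega)]
      simp only [reduceCtorEq, false_iff]
      omega

lemma rep_none {c : Fin k → Fin (2 * k)} {l : List (Option (Fin k))} (h : Rep c l) {q : ℕ}
    {e : Option (Fin k)} (he : l[q]? = some e) (hq : ∀ t, (c t).val ≠ q) : e = none := by
  cases e with
  | none => rfl
  | some t => exact absurd ((h.2 t q).1 he) (hq t)

lemma rep_unique {c c' : Fin k → Fin (2 * k)} {l : List (Option (Fin k))} (h : Rep c l)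
    (h' : Rep c' l) : c = c' := by
  funext t
  apply Fin.ext
  exact ((h'.2 t _).1 ((h.2 t _).2 rfl)).symm

lemma rep_inj {c : Fin k → Fin (2 * k)} {l : List (Option (Fin k))} (h : Rep c l) :
    Function.Injective c := by
  intro t t' he
  have h1 := (h.2 t _).2 rfl
  have h2 := (h.2 t' _).2 rfl
  rw [he, h2] at h1
  simpa using h1.symm

def relbl (τ : Equiv.Perm (Fin k)) (l : List (Option (Fin k))) : List (Option (Fin k)) :=
  l.map (Option.map τ)

lemma rep_relbl {c : Fin k → Fin (2 * k)} {l : List (Option (Fin k))} (τ : Equiv.Perm (Fin k)) :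
    Rep c (relbl τ l) ↔ Rep (fun t => c (τ t)) l := by
  unfold Rep relbl
  simp only [List.length_map, List.getElem?_map]
  refine and_congr_right fun _ => ?_
  have key : ∀ (t : Fin k) (q : ℕ), Option.map (Option.map τ) l[q]? = some (some t) ↔ l[q]? = some (some (τ.symm t)) := by
    intro t q
    constructor
    · intro h
      rcases hq : l[q]? with _ | _ | t'
      · simp [hq] at h
      · simp [hq] at h
      · simp [hq] at h; simp [← h]
    · intro h; simp [h]
  constructor
  · intro h t q
    have := h (τ t) q
    rw [key, Equiv.symm_apply_apply] at this
    exact this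
  · intro h t q
    rw [key, h]; simp

def bits (l : List (Option (Fin k))) : List Bool := l.map Option.isSome

lemma bits_relbl (τ : Equiv.Perm (Fin k)) (l : List (Option (Fin k))) : bits (relbl τ l) = bits l := by
  simp [bits, relbl]

@[simp] lemma bits_cons (x : Option (Fin k)) (l) : bits (x :: l) = x.isSome :: bits l := rfl
@[simp] lemma bits_append (l l' : List (Option (Fin k))) : bits (l ++ l') = bits l ++ bits l' := by
  simp [bits]
@[simp] lemma bits_length (l : List (Option (Fin k))) : (bits l).length = l.length := by
  simp [bits]

def Mv (l l' : List (Option (Fin k))) : Prop :=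
  ∃ x p q a b, l = x :: (p ++ q) ∧ l' = p ++ x :: q ∧ bits p = Pre a b

noncomputable def Rk (l : List (Option (Fin k))) : ℕ := R (bits l).reverse

lemma Mv.rk {l l' : List (Option (Fin k))} (h : Mv l l') : Rk l' = Rk l + 1 := by
  obtain ⟨x, p, q, a, b, rfl, rfl, hp⟩ := h
  have := R_move x.isSome a b (bits q).reverse
  simp only [Rk, bits_cons, bits_append, hp, List.reverse_cons, List.reverse_append,
    List.append_assoc, List.singleton_append] at this ⊢
  exact this

lemma Mv.unique {l l' l'' : List (Option (Fin k))} (h : Mv l l') (h2 : Mv l l'') : l' = l'' := by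
  obtain ⟨x, p, q, a, b, rfl, rfl, hp⟩ := h
  obtain ⟨x', p', q', a', b', e, rfl, hp'⟩ := h2
  simp only [List.cons.injEq] at e
  obtain ⟨rfl, e⟩ := e
  have e2 := congrArg bits e
  simp only [bits_append, hp, hp'] at e2
  obtain ⟨rfl, rfl⟩ := Pre_unique e2
  have hl : p.length = p'.length := by
    rw [← bits_length, ← bits_length, hp, hp']
  obtain ⟨rfl, rfl⟩ := List.append_inj e hl
  rfl

lemma Mv.relbl {l l' : List (Option (Fin k))} (h : Mv l l') (τ : Equiv.Perm (Fin k)) :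
    Mv (relbl τ l) (relbl τ l') := by
  obtain ⟨x, p, q, a, b, rfl, rfl, hp⟩ := h
  refine ⟨x.map τ, Depth.relbl τ p, Depth.relbl τ q, a, b, by simp [Depth.relbl], by simp [Depth.relbl], ?_⟩
  rw [bits_relbl, hp]

lemma Mv.perm {l l' : List (Option (Fin k))} (h : Mv l l') : l'.Perm l := by
  obtain ⟨x, p, q, a, b, rfl, rfl, hp⟩ := h
  exact List.perm_middle

lemma rep_hold_many (p : List (Option (Fin k))) : ∀ (c : Fin k → Fin (2 * k)) x y,
    Rep c (x :: (p ++ y)) → ∃ c', Rep c' (x :: (y ++ p)) := by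
  induction p with
  | nil => intro c x y h; exact ⟨c, by simpa using h⟩
  | cons e p ih =>
    intro c x y h
    have := rep_hld (by simpa using h : Rep c (x :: e :: (p ++ y)))
    rw [List.append_assoc] at this
    obtain ⟨c', h'⟩ := ih _ _ _ this
    exact ⟨c', by simpa using h'⟩

lemma rep_nrm_many (p : List (Option (Fin k))) : ∀ (c : Fin k → Fin (2 * k)) y,
    Rep c (p ++ y) → ∃ c', Rep c' (y ++ p) := by
  induction p with
  | nil => intro c y h; exact ⟨c, by simpa using h⟩
  | cons e p ih =>
    intro c y h
    have := rep_nrm (by simpa using h : Rep c (e :: (p ++ y)))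
    rw [List.append_assoc] at this
    obtain ⟨c', h'⟩ := ih _ _ this
    exact ⟨c', by simpa using h'⟩

lemma Mv.rep {l l' : List (Option (Fin k))} (h : Mv l l') {c} (hc : Rep c l) : ∃ c', Rep c' l' := by
  obtain ⟨x, p, q, a, b, rfl, rfl, hp⟩ := h
  obtain ⟨c1, h1⟩ := rep_hold_many p c x q hc
  obtain ⟨c2, h2⟩ := rep_nrm_many (x :: q) c1 p (by simpa using h1)
  exact ⟨c2, h2⟩

lemma mv_exists {l : List (Option (Fin k))} (h0 : 0 < Rk l)
    (h1 : Rk l + 1 < Nat.choose l.length ((bits l).count false)) : ∃ l', Mv l l' := by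
  obtain ⟨x, a, b, q, h⟩ := exists_move (bits l) h0 (by simpa [Rk] using h1)
  cases l with
  | nil => simp [bits] at h
  | cons e l =>
    simp only [bits_cons, List.cons.injEq] at h
    obtain ⟨h, h'⟩ := h
    obtain ⟨p, q', hl, hp, hq⟩ := List.map_eq_append_iff.1 h'
    exact ⟨_, e, p, q', a, b, by rw [hl], rfl, hp⟩

/-- The enumeration of all arrangements in one round. -/
lemma exists_chain (hk : 1 ≤ k) : ∃ L : ℕ → List (Option (Fin k)),
    (∀ i, i + 2 < Nat.choose (2 * k) k → Mv (L i) (L (i + 1))) ∧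
    (∀ i, i + 2 ≤ Nat.choose (2 * k) k → Rk (L i) = i + 1 ∧ (L i).length = 2 * k ∧
      (bits (L i)).count false = k ∧ ∃ c, Rep c (L i)) := by
  classical
  let nx : List (Option (Fin k)) → List (Option (Fin k)) := fun l =>
    if h : ∃ l', Mv l l' then h.choose else l
  have hnx : ∀ l, (∃ l', Mv l l') → Mv l (nx l) := by
    intro l h
    simp only [nx, dif_pos h]
    exact h.choose_spec
  obtain ⟨m, rfl⟩ : ∃ m, k = m + 1 := ⟨k - 1, by omega⟩
  let l0 : List (Option (Fin (m+1))) :=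
    (List.finRange (m+1)).tail.map some ++ (List.replicate (m+1) none ++ [some 0])
  have hl0 : ∃ c, Rep c l0 := by
    have h1 : Rep (fun t : Fin (m+1) => (⟨t.val, by have := t.2; omega⟩ : Fin (2*(m+1))))
        ((List.finRange (m+1)).map some ++ List.replicate (m+1) none) := by
      refine ⟨by simp; omega, fun t q => ?_⟩
      rcases lt_or_ge q (m+1) with hq | hq
      · rw [List.getElem?_append_left (by simpa using hq)]
        rw [List.getElem?_map, List.getElem?_eq_getElem (by simpa using hq)]
        simp [Fin.ext_iff]
        exact eq_comm
      · rw [List.getElem?_append_right (by simpa using hq)]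
        have := t.2
        constructor
        · intro h
          have := List.mem_of_getElem? h
          simp at this
        · intro h; simp only at h; omega
    rw [List.finRange_succ] at h1
    have h2 := rep_nrm h1
    have e : l0 = (List.map some (List.map Fin.succ (List.finRange m))).append
        (List.replicate (m + 1) none) ++ [some 0] := by
      simp [l0, List.finRange_succ]
    rw [e]
    exact ⟨_, h2⟩
  have hb0 : bits l0 = List.replicate m true ++ (List.replicate (m+1) false ++ [true]) := by
    simp only [l0, bits_append]
    congr 1
    · simp [bits, List.eq_replicate_iff, List.finRange_succ]
    · congr 1
      simp [bits]
  have hR0 : Rk l0 = 1 := by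
    rw [Rk, hb0]
    have n3 := not_srt (List.replicate m true) [] m
    have e : (List.replicate m true ++ (List.replicate (m+1) false ++ [true])).reverse =
      true :: (List.replicate (m+1) false ++ List.replicate m true) := by simp
    rw [e, R, if_neg (by simpa using n3), R_srt ⟨m, m+1, rfl⟩]; rfl
  have key : ∀ i, i + 2 ≤ Nat.choose (2 * (m+1)) (m+1) → Rk (nx^[i] l0) = i + 1 ∧ (nx^[i] l0).length = 2 * (m+1) ∧
      (bits (nx^[i] l0)).count false = m+1 ∧ ∃ c, Rep c (nx^[i] l0) := by
    intro i
    induction i with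
    | zero =>
      intro _
      refine ⟨hR0, ?_, ?_, hl0⟩
      · obtain ⟨c, hc⟩ := hl0; exact hc.1
      · show (bits l0).count false = _
        rw [hb0]; simp [List.count_replicate]
    | succ i ih =>
      intro hi
      obtain ⟨h1, h2, h3, c, h4⟩ := ih (by omega)
      have hm : Mv (nx^[i] l0) (nx^[i+1] l0) := by
        rw [Function.iterate_succ_apply']
        apply hnx
        apply mv_exists (by omega)
        rw [h1, h2, h3]; omega
      refine ⟨by rw [hm.rk, h1], by rw [hm.perm.length_eq, h2], ?_, hm.rep h4⟩
      exact ((hm.perm.map _).count_eq _).trans h3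
  refine ⟨fun i => nx^[i] l0, fun i hi => ?_, key⟩
  obtain ⟨h1, h2, h3, _⟩ := key i (by omega)
  show Mv (nx^[i] l0) (nx^[i+1] l0)
  rw [Function.iterate_succ_apply']
  apply hnx
  refine mv_exists (l := nx^[i] l0) (by omega) ?_
  rw [h1, h2, h3]; omega

/-! ### Analysis of one pass -/

def Agree (g : List Bool) (p : List (Option (Fin k))) : Prop :=
  List.Forall₂ (fun b e => b = false → e = none) g p

lemma agree_count {g : List Bool} {p : List (Option (Fin k))} (h : Agree g p) :
    g.count false ≤ (bits p).count false ∧ (g.count false = (bits p).count false → g = bits p) := by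
  induction h with
  | nil => simp [bits]
  | @cons b e g p hbe _ ih =>
    cases b with
    | false =>
      have := hbe rfl
      subst this
      simp only [bits_cons, Option.isSome_none, List.count_cons_self]
      refine ⟨by omega, fun h => ?_⟩
      rw [ih.2 (by omega)]
    | true =>
      cases e with
      | none =>
        simp only [bits_cons, Option.isSome_none, List.count_cons_self]
        rw [List.count_cons_of_ne (by simp)]
        refine ⟨by omega, fun h => ?_⟩
        omega
      | some t =>
        simp only [bits_cons, Option.isSome_some]
        rw [List.count_cons_of_ne (by simp), List.count_cons_of_ne (by simp)]
        refine ⟨by omega, fun h => ?_⟩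
        rw [ih.2 (by omega)]

lemma Agree.snoc {g : List Bool} {p : List (Option (Fin k))} (h : Agree g p) {b e}
    (hb : b = false → e = none) : Agree (g ++ [b]) (p ++ [e]) :=
  List.rel_append h (List.Forall₂.cons hb List.Forall₂.nil)

def Shape (ph : Fin 4) (g : List Bool) : Prop :=
  (ph = 0 ∧ ∃ a, g = List.replicate a true) ∨
  (ph = 1 ∧ ∃ a b, g = List.replicate a true ++ List.replicate (b+1) false) ∨
  (ph = 2 ∧ ∃ a b, g = Pre a b)

lemma shape_step {ph ph' : Fin 4} {g : List Bool} {b : Bool} (h : Shape ph g)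
    (h' : phs true b ph = some ph') : Shape ph' (g ++ [b]) ∧ ph' ≠ 3 := by
  rcases h with ⟨rfl, a, rfl⟩ | ⟨rfl, a, c, rfl⟩ | ⟨rfl, a, c, rfl⟩
  · cases b
    · simp [phs] at h'
      subst h'
      exact ⟨.inr (.inl ⟨rfl, a, 0, by simp⟩), by decide⟩
    · simp [phs] at h'
      subst h'
      exact ⟨.inl ⟨rfl, a+1, by simp [List.replicate_succ']⟩, by decide⟩
  · cases b
    · simp [phs] at h'
      subst h'
      exact ⟨.inr (.inl ⟨rfl, a, c+1, by simp [List.replicate_succ']⟩), by decide⟩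
    · simp [phs] at h'
      subst h'
      exact ⟨.inr (.inr ⟨rfl, a, c, by simp [Pre]⟩), by decide⟩
  · cases b <;> simp [phs] at h'

def Pass (l0 : List (Option (Fin k))) (g : List Bool) (ph : Fin 4) (c : Fin k → Fin (2 * k)) : Prop :=
  (2 * k ≤ g.length ∧ (2 * k < g.length ∨ ph ≠ 3)) ∨
  (ph ≠ 3 ∧ Shape ph g ∧ ∃ x p y, l0 = x :: (p ++ y) ∧ Rep c (x :: (y ++ p)) ∧ Agree g p) ∨
  (ph = 3 ∧ ∃ x p q y a b gx gq, l0 = x :: (p ++ (q ++ y)) ∧ Rep c (y ++ (p ++ x :: q)) ∧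
    g = Pre a b ++ gx :: gq ∧ Agree (Pre a b) p ∧ (gx = false → x = none) ∧ Agree gq q)

lemma pass_step {l0 : List (Option (Fin k))} {g : List Bool} {ph ph' : Fin 4}
    {c : Fin k → Fin (2 * k)} {hold b : Bool} (h : Pass l0 g ph c) (hl : l0.length = 2 * k)
    (h' : phs hold b ph = some ph') (h4 : b = false → ∀ t, (c t).val ≠ hold.toNat) :
    Pass l0 (g ++ [b]) ph' (fun t => mvm hold (c t)) := by
  rcases h with ⟨h1, _⟩ | ⟨h1, h2, x, p, y, rfl, h3, h5⟩ | ⟨rfl, x, p, q, y, a, b', gx, gq, rfl, h3, rfl, h5, h6, h7⟩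
  · left
    simp only [List.length_append, List.length_singleton]
    exact ⟨by omega, .inl (by omega)⟩
  · have hlen : g.length = p.length := h5.length_eq
    simp only [List.length_cons, List.length_append] at hl
    cases hold with
    | true =>
      obtain ⟨s1, s2⟩ := shape_step h2 h'
      cases y with
      | nil =>
        left
        simp only [List.length_append, List.length_singleton, List.length_nil] at hl ⊢
        exact ⟨by omega, .inr s2⟩
      | cons e y =>
        right; left
        refine ⟨s2, s1, x, p ++ [e], y, by simp, ?_, h5.snoc ?_⟩
        · have := rep_hld (by simpa using h3 : Rep c (x :: e :: (y ++ p)))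
          rw [List.append_assoc] at this
          exact this
        · intro hb
          exact rep_none h3 (q := 1) (by simp) (h4 hb)
    | false =>
      right; right
      have hph : ph = 2 ∧ ph' = 3 := by
        simp only [phs, Bool.false_eq_true, if_false] at h'
        split_ifs at h' with hh
        · simp at h'; exact ⟨by tauto, h'.symm⟩
      obtain ⟨rfl, rfl⟩ := hph
      obtain ⟨a, b', rfl⟩ : ∃ a b, g = Pre a b := by
        rcases h2 with ⟨h, _⟩ | ⟨h, _⟩ | ⟨_, h⟩
        · exact absurd h (by decide)
        · exact absurd h (by decide)
        · exact h
      refine ⟨rfl, x, p, [], y, a, b', b, [], by simp, ?_, rfl, h5, ?_, List.Forall₂.nil⟩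
      · have := rep_nrm h3
        rw [List.append_assoc] at this
        exact this
      · intro hb
        exact rep_none h3 (q := 0) (by simp) (h4 hb)
  · have hlen : (Pre a b').length = p.length := h5.length_eq
    have hlen' : gq.length = q.length := h7.length_eq
    simp only [List.length_cons, List.length_append] at hl
    cases hold with
    | true => cases b <;> simp [phs] at h'
    | false =>
      cases y with
      | nil =>
        left
        simp only [List.length_append, List.length_singleton, List.length_nil, List.length_cons] at hl ⊢
        exact ⟨by omega, .inl (by omega)⟩
      | cons e y =>
        right; right
        simp [phs] at h'
        refine ⟨h'.symm, x, p, q ++ [e], y, a, b', gx, gq ++ [b], by simp, ?_, by simp, h5, h6, h7.snoc ?_⟩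
        · have := rep_nrm (by simpa using h3 : Rep c (e :: (y ++ (p ++ x :: q))))
          simpa [mvm] using this
        · intro hb
          exact rep_none h3 (q := 0) (by simp) (h4 hb)

lemma count_tf (g : List Bool) : g.count false + g.count true = g.length := by
  induction g with
  | nil => rfl
  | cons b g ih => cases b <;> simp <;> omega

lemma pass_end {l0 : List (Option (Fin k))} {g : List Bool} {c : Fin k → Fin (2 * k)}
    (h : Pass l0 g 3 c) (hl : l0.length = 2 * k) (hc : (bits l0).count false = k)
    (h0 : g.count false = k) (h1 : g.count true = k) : ∃ l', Mv l0 l' ∧ Rep c l' := by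
  have hg := count_tf g
  rcases h with ⟨_, h⟩ | ⟨h, _⟩ | ⟨_, x, p, q, y, a, b', gx, gq, rfl, h3, rfl, h5, h6, h7⟩
  · exfalso
    rcases h with h | h
    · omega
    · exact h rfl
  · exact absurd rfl h
  · have hlen : (Pre a b').length = p.length := h5.length_eq
    have hlen' : gq.length = q.length := h7.length_eq
    simp only [List.length_append, List.length_cons] at hl hg
    have hy : y = [] := List.eq_nil_of_length_eq_zero (by omega)
    subst hy
    have hag : Agree (gx :: (Pre a b' ++ gq)) (x :: (p ++ q)) :=
      List.Forall₂.cons h6 (List.rel_append h5 h7)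
    have := (agree_count hag).2 (by
      simp only [List.append_nil] at hc
      rw [hc]
      rw [← h0]
      exact (List.perm_middle.symm).count_eq _)
    simp only [bits_cons, bits_append, List.cons.injEq] at this
    have h8 := (List.append_inj this.2 (by simpa using hlen)).1
    exact ⟨p ++ x :: q, ⟨x, p, q, a, b', by simp, rfl, h8.symm⟩, by simpa using h3⟩

end
end Depth

namespace Depth
section
variable {k s : ℕ}

lemma pass_nil {l : List (Option (Fin k))} {ph : Fin 4} {c : Fin k → Fin (2 * k)} (hk : 1 ≤ k)
    (h : Pass l [] ph c) : Rep c l := by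
  rcases h with ⟨h1, _⟩ | ⟨h1, h2, x, p, y, rfl, h3, h5⟩ | ⟨rfl, x, p, q, y, a, b', gx, gq, rfl, h3, h4, h5, h6, h7⟩
  · simp at h1; omega
  · have : p = [] := List.eq_nil_of_length_eq_zero h5.length_eq.symm
    subst this
    simpa using h3
  · simp at h4

lemma pass_start {l : List (Option (Fin k))} {c : Fin k → Fin (2 * k)} (hk : 1 ≤ k)
    (h : Rep c l) : Pass l [] 0 c := by
  cases l with
  | nil => have := h.1; simp at this; omega
  | cons x y =>
    right; left
    exact ⟨by decide, .inl ⟨rfl, 0, rfl⟩, x, [], y, rfl, by simpa using h, List.Forall₂.nil⟩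

lemma rep_list_unique {c : Fin k → Fin (2 * k)} {l l' : List (Option (Fin k))} (h : Rep c l)
    (h' : Rep c l') : l = l' := by
  apply List.ext_getElem?
  intro q
  rcases hq : l[q]? with _ | _ | t
  · rw [eq_comm, List.getElem?_eq_none_iff, h'.1, ← h.1, ← List.getElem?_eq_none_iff, hq]
  · have hlt : q < l'.length := by
      rw [h'.1, ← h.1]
      exact (List.getElem?_eq_some_iff.1 hq).1
    rw [List.getElem?_eq_getElem hlt]
    rcases hq' : l'[q] with _ | t
    · rfl
    · exfalso
      have h1 := (h'.2 t q).1 (by rw [List.getElem?_eq_getElem hlt, hq'])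
      have := (h.2 t q).2 h1
      rw [hq] at this
      simp at this
  · exact ((h'.2 t q).2 ((h.2 t q).1 hq)).symm

lemma rep_bits_eq {c c' : Fin k → Fin (2 * k)} {l l' : List (Option (Fin k))} (h : Rep c l)
    (h' : Rep c' l') (hl : (bits l).count false = k) (hl' : (bits l').count false = k)
    (hr : ∀ t, ∃ t', c' t' = c t) : bits l' = bits l := by
  apply (agree_count (?_ : Agree (bits l') l)).2 (by rw [hl, hl'])
  rw [Agree, List.forall₂_iff_get]
  refine ⟨by rw [bits_length, h.1, h'.1], ?_⟩
  intro i h1 h2 h3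
  simp only [bits, List.get_eq_getElem, List.getElem_map, Option.isSome_eq_false_iff,
    Option.isNone_iff_eq_none] at h3 ⊢
  rcases hq : l[i] with _ | t
  · rfl
  · exfalso
    have h4 := (h.2 t i).1 (by rw [List.getElem?_eq_getElem h2, hq])
    obtain ⟨t', ht'⟩ := hr t
    have h5 := (h'.2 t' i).2 (by rw [ht', h4])
    rw [List.getElem?_eq_getElem (by simpa using h1), h3] at h5
    simp at h5

/-- The data describing one round of the enumeration. -/
structure Dat (k : ℕ) where
  L : ℕ → List (Option (Fin k))
  Z : ℕ
  c0 : Fin k → Fin (2 * k)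
  cZ : Fin k → Fin (2 * k)
  σ : Equiv.Perm (Fin k)
  hk : 1 ≤ k
  hN : Nat.choose (2 * k) k = Z + 2
  mv : ∀ i, i < Z → Mv (L i) (L (i + 1))
  rk : ∀ i, i ≤ Z → Rk (L i) = i + 1
  len : ∀ i, i ≤ Z → (L i).length = 2 * k
  cnt : ∀ i, i ≤ Z → (bits (L i)).count false = k
  r0 : Rep c0 (L 0)
  rZ : Rep cZ (L Z)

open Classical in
noncomputable def Dat.Wm (D : Dat k) (q : Fin (2 * k)) : Option (Fin (2 * k)) :=
  if h : ∃ t, D.cZ t = q then some (D.c0 (D.σ.symm h.choose)) else none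

lemma Dat.Wm_some (D : Dat k) (t : Fin k) : D.Wm (D.cZ t) = some (D.c0 (D.σ.symm t)) := by
  have h : ∃ t', D.cZ t' = D.cZ t := ⟨t, rfl⟩
  rw [Dat.Wm, dif_pos h, rep_inj D.rZ h.choose_spec]

lemma Dat.Wm_mem (D : Dat k) {q q'} (h : D.Wm q = some q') : ∃ t, D.cZ t = q := by
  by_contra hn
  rw [Dat.Wm, dif_neg hn] at h
  simp at h

def Kb (k s : ℕ) (j : ZMod s) : Bool := k.testBit j.val

def Inv (D : Dat k) [NeZero s] (S : St k s) (n : ℕ) : Prop :=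
  ∃ w ρ, ∃ g : List Bool, ρ ≤ D.Z ∧ (∀ u, S.val u = k - g.count u) ∧
    w * (2 * D.Z + 1) + 2 * ρ + g.length ≤ n ∧ Pass (relbl (D.σ ^ w) (D.L ρ)) g S.ph S.c

lemma relbl_length (τ : Equiv.Perm (Fin k)) (l : List (Option (Fin k))) :
    (relbl τ l).length = l.length := by simp [relbl]

lemma Dat.wrap_rep (D : Dat k) {c : Fin k → Fin (2 * k)} {w : ℕ}
    (h : Rep c (relbl (D.σ ^ w) (D.L D.Z))) :
    ∃ c', (∀ t, D.Wm (c t) = some (c' t)) ∧ Rep c' (relbl (D.σ ^ (w + 1)) (D.L 0)) := by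
  refine ⟨fun t => D.c0 (D.σ.symm ((D.σ ^ w).symm t)), ?_, ?_⟩
  · intro t
    rw [rep_relbl] at h
    have := rep_unique h D.rZ
    have h2 := congrFun this ((D.σ ^ w).symm t)
    simp only [Equiv.apply_symm_apply] at h2
    rw [h2, D.Wm_some]
  · rw [rep_relbl]
    have : (fun t => D.c0 (D.σ.symm ((D.σ ^ w).symm ((D.σ ^ (w+1)) t)))) = D.c0 := by
      funext t
      rw [pow_succ, Equiv.Perm.mul_apply, Equiv.symm_apply_apply, Equiv.symm_apply_apply]
    rw [this]
    exact D.r0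

lemma g_nil {g : List Bool} {f : Bool → ℤ} (h : ∀ u, f u = (k : ℤ) - g.count u) (h' : ∀ u, f u = k) :
    g = [] := by
  have h1 := h false
  have h2 := h true
  rw [h'] at h1 h2
  have := count_tf g
  exact List.eq_nil_of_length_eq_zero (by omega)

lemma inv_step (D : Dat k) [NeZero s] (hs : k < 2 ^ s) {l : Ltr} {S : St k s} {n : ℕ} (h : Inv D S n)
    (ha : Alive (Kb k s) D.Wm l S) :
    ∃ S', Step (Kb k s) D.Wm l S S' ∧ Inv D S' (n + 1) := by
  have hK : bv (Kb k s) = k := bv_K hs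
  obtain ⟨w, ρ, g, h1, h2, h3, h4⟩ := h
  have hlen : (relbl (D.σ ^ w) (D.L ρ)).length = 2 * k := by rw [relbl_length, D.len _ h1]
  cases l with
  | rd hold b =>
    obtain ⟨a1, a2, ⟨ph', a3⟩, a4⟩ := alive_rd _ _ ha
    refine ⟨_, step_rd _ _ a1 a2 a3 a4, w, ρ, g ++ [b], h1, ?_, ?_, pass_step h4 hlen a3 a4⟩
    · intro u
      rw [val_rd a1 a2, h2]
      by_cases hb : b = u
      · subst hb; simp; ring
      · simp [hb]
    · simp only [List.length_append, List.length_singleton]; omega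
  | d0 u =>
    obtain ⟨a1, a2⟩ := alive_d0 _ _ ha
    exact ⟨_, step_d0 _ _ a1 a2, w, ρ, g, h1, fun u => by rw [val_d0 a1 a2, h2], by omega, h4⟩
  | d1 u =>
    obtain ⟨a1, a2, a3⟩ := alive_d1 _ _ ha
    exact ⟨_, step_d1 _ _ a1 a2 a3, w, ρ, g, h1, fun u => by rw [val_d1 a1 a2 a3, h2], by omega, h4⟩
  | rot =>
    have a1 := alive_rot _ _ ha
    exact ⟨_, step_rot _ _ a1, w, ρ, g, h1, fun u => by rw [val_rot a1, h2], by omega, h4⟩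
  | fin =>
    obtain ⟨a1, a2, a3, a4⟩ := alive_fin _ _ ha
    have hv : ∀ u, g.count u = k := by
      intro u
      have : S.val u = 0 := by
        simp [St.val, pv, a1, bv, a4]
      have := h2 u
      omega
    rw [a3] at h4
    have hbc : (bits (relbl (D.σ ^ w) (D.L ρ))).count false = k := by rw [bits_relbl, D.cnt _ h1]
    obtain ⟨l', m1, m2⟩ := pass_end h4 hlen hbc (hv _) (hv _)
    have hρ : ρ + 1 ≤ D.Z := by
      have e1 := m1.rk
      have e2 := R_lt (bits l').reverse
      have e3 : ((bits l').reverse).count false = k := by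
        rw [List.count_reverse]
        exact ((m1.perm.map _).count_eq _).trans hbc
      have e4 : ((bits l').reverse).length = 2 * k := by
        rw [List.length_reverse, bits_length, m1.perm.length_eq, hlen]
      have e5 : Rk (relbl (D.σ ^ w) (D.L ρ)) = ρ + 1 := by
        rw [Rk, bits_relbl]; exact D.rk _ h1
      rw [e3, e4, D.hN] at e2
      change Rk l' < _ at e2
      omega
    have e := m1.unique ((D.mv ρ (by omega)).relbl (D.σ ^ w))
    subst e
    refine ⟨_, step_fin _ _ a1 a2 a3 a4, w, ρ + 1, [], hρ, ?_, ?_, pass_start D.hk m2⟩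
    · intro u
      have : bv (fun j => Kb k s j) = k := hK
      simp [St.val, pv, a1, this]
    · have := count_tf g
      have := hv true
      have := hv false
      have := D.hk
      simp only [List.length_nil]
      omega
  | wrap =>
    obtain ⟨a1, a2, a3, a4, a5⟩ := alive_wrap _ _ ha
    have hval : ∀ u, S.val u = k := by
      intro u
      have : S.β u = Kb k s := funext (a4 u)
      simp [St.val, pv, a1, this, hK]
    have hg := g_nil h2 hval
    subst hg
    have hrep := pass_nil D.hk h4
    have hb : bits (D.L D.Z) = bits (relbl (D.σ ^ w) (D.L ρ)) := by
      apply rep_bits_eq hrep D.rZ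
      · rw [bits_relbl, D.cnt _ h1]
      · exact D.cnt _ le_rfl
      · intro t
        obtain ⟨q, hq⟩ := a5 t
        exact D.Wm_mem hq
    have hρ : ρ = D.Z := by
      have e1 := D.rk _ h1
      have e2 := D.rk _ (le_refl D.Z)
      rw [bits_relbl] at hb
      rw [Rk, hb] at e2
      rw [Rk] at e1
      omega
    subst hρ
    obtain ⟨c', b1, b2⟩ := D.wrap_rep hrep
    refine ⟨_, step_wrap _ _ a1 a2 a3 a4 b1, w + 1, 0, [], by omega, ?_, ?_, ?_⟩
    · intro u
      have := hval u
      simpa [St.val] using this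
    · simp only [List.length_nil] at h3 ⊢
      rw [add_mul]
      omega
    · simp only [a3]
      exact pass_start D.hk b2

lemma inv_run (D : Dat k) [NeZero s] (hs : k < 2 ^ s) (T : St k s) (wd : List Ltr) :
    ∀ (S : St k s) (n : ℕ), Inv D S n →
      (∀ t, run (act (Kb k s) D.Wm) wd (S.pos t) = some (T.pos t)) → Inv D T (n + wd.length) := by
  induction wd with
  | nil =>
    intro S n h hr
    have : S = T := pos_inj fun t => by simpa [run] using hr t
    subst this
    exact h
  | cons l wd ih =>
    intro S n h hr
    have ha : Alive (Kb k s) D.Wm l S := by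
      intro t
      have := hr t
      rw [run, Option.bind_eq_some_iff] at this
      obtain ⟨q, hq, _⟩ := this
      exact ⟨q, hq⟩
    obtain ⟨S', st, h'⟩ := inv_step D hs h ha
    have := ih S' (n + 1) h' fun t => by
      have := hr t
      rw [run, st t] at this
      simpa using this
    rw [List.length_cons]
    convert this using 1
    omega

/-- A state at the beginning of a pass. -/
def Good (S : St k s) (l : List (Option (Fin k))) : Prop :=
  S.pd = none ∧ S.h = 0 ∧ S.ph = 0 ∧ (∀ u, S.β u = Kb k s) ∧ Rep S.c l

lemma Good.val [NeZero s] (hs : k < 2 ^ s) {S : St k s} {l} (h : Good S l) (u : Bool) : S.val u = k := by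
  obtain ⟨a1, a2, a3, a4, a5⟩ := h
  have hK : bv (Kb k s) = k := bv_K hs
  simp [St.val, pv, a1, a4, hK]

lemma lower (D : Dat k) [NeZero s] (hs : k < 2 ^ s) {S T : St k s} {n : ℕ} (wd : List Ltr)
    (hS : Good S (D.L 0)) (hn : orderOf D.σ = n + 1)
    (hT : Good T (relbl (D.σ ^ n) (D.L D.Z)))
    (hr : ∀ t, run (act (Kb k s) D.Wm) wd (S.pos t) = some (T.pos t)) :
    n * (2 * D.Z + 1) + 2 * D.Z ≤ wd.length := by
  have h0 : Inv D S 0 := by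
    refine ⟨0, 0, [], by omega, fun u => by simp [hS.val hs], by simp, ?_⟩
    obtain ⟨a1, a2, a3, a4, a5⟩ := hS
    rw [a3]
    apply pass_start D.hk
    rw [rep_relbl]
    simpa using a5
  obtain ⟨w, ρ, g, h1, h2, h3, h4⟩ := inv_run D hs T wd S 0 h0 hr
  have hg := g_nil h2 (hT.val hs)
  subst hg
  have hrep := pass_nil D.hk h4
  obtain ⟨a1, a2, a3, a4, a5⟩ := hT
  have e := rep_list_unique hrep a5
  have hρ : ρ = D.Z := by
    have e1 := D.rk _ h1
    have e2 := D.rk _ (le_refl D.Z)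
    have e3 := congrArg bits e
    rw [bits_relbl, bits_relbl] at e3
    rw [Rk, ← e3] at e2
    rw [Rk] at e1
    omega
  subst hρ
  have hinj := rep_inj hrep
  rw [rep_relbl] at hrep a5
  have hf := rep_unique hrep a5
  have hσ : D.σ ^ w = D.σ ^ n := by
    ext t
    have := hinj (congrFun hf t)
    rw [this]
  rw [pow_eq_pow_iff_modEq, hn] at hσ
  have hw : n ≤ w := by
    have : w % (n + 1) = n := by rw [hσ, Nat.mod_eq_of_lt (by omega)]
    have := Nat.mod_le w (n + 1)
    omega
  have := Nat.mul_le_mul_right (2 * D.Z + 1) hw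
  simp only [List.length_nil] at h3
  omega

end
end Depth

namespace Depth
section
variable {k s : ℕ}

/-! ### Liveness -/

def Reach (D : Dat k) (S S' : St k s) : Prop :=
  ∃ wd, ∀ t, run (act (Kb k s) D.Wm) wd (S.pos t) = some (S'.pos t)

lemma Reach.refl (D : Dat k) (S : St k s) : Reach D S S := ⟨[], fun _ => rfl⟩

lemma Reach.trans {D : Dat k} {S S' S'' : St k s} (h : Reach D S S') (h' : Reach D S' S'') :
    Reach D S S'' := by
  obtain ⟨w, hw⟩ := h
  obtain ⟨w', hw'⟩ := h'
  exact ⟨w ++ w', fun t => by rw [run_append, hw, Option.bind_some, hw']⟩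

lemma Reach.step {D : Dat k} {S S' : St k s} {l : Ltr} (h : Step (Kb k s) D.Wm l S S') :
    Reach D S S' := ⟨[l], fun t => by simp [run, h t]⟩

lemma reach_rot (D : Dat k) (n : ℕ) : ∀ (S : St k s), S.pd = none → Reach D S { S with h := S.h + n } := by
  induction n with
  | zero => intro S _; simpa using Reach.refl D S
  | succ n ih =>
    intro S h
    refine (Reach.step (step_rot _ _ h)).trans ?_
    have := ih { S with h := S.h + 1 } h
    convert this using 2
    push_cast
    ring

lemma bv_true [NeZero s] : bv (fun _ : ZMod s => true) = 2 ^ s - 1 := by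
  have h : (2 ^ s - 1 : ℕ) < 2 ^ s := Nat.sub_lt (by positivity) one_pos
  have h1 := bv_K (s := s) h
  have h2 : (fun j : ZMod s => (2 ^ s - 1).testBit j.val) = fun _ => true := by
    funext j
    rw [Nat.testBit_two_pow_sub_one]
    simpa using ZMod.val_lt j
  rw [h2] at h1
  rw [h1, Nat.cast_sub Nat.one_le_two_pow]
  simp

lemma last_val [NeZero s] {h : ZMod s} (h1 : h + 1 = 0) : h.val + 1 = s := by
  have h2 : ((h.val + 1 : ℕ) : ZMod s) = 0 := by
    push_cast
    rw [ZMod.natCast_zmod_val, h1]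
  rw [ZMod.natCast_eq_zero_iff] at h2
  have := Nat.le_of_dvd (by omega) h2
  have := ZMod.val_lt h
  omega

lemma bv_last [NeZero s] {β : ZMod s → Bool} {h : ZMod s} (h1 : h + 1 = 0) (hb : β h = false) :
    bv β < 2 ^ h.val := by
  have e1 : bv β ≤ bv (Function.update (fun _ => true) h false) := by
    unfold bv
    apply Finset.sum_le_sum
    intro j _
    by_cases hj : j = h
    · subst hj; simp [hb]
    · rw [Function.update_of_ne hj]
      by_cases hbj : β j = true <;> simp [hbj]
  rw [bv_update, bv_true] at e1
  have := last_val h1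
  have e2 : (2 : ℤ) ^ s = 2 ^ h.val * 2 := by rw [← pow_succ, this]
  rw [e2] at e1
  simp at e1
  linarith

/-- A clean state with the same configuration and given counter values. -/
def Fix [NeZero s] (S' : St k s) (c : Fin k → Fin (2 * k)) (ph : Fin 4) (v : Bool → ℤ) : Prop :=
  S'.c = c ∧ S'.ph = ph ∧ S'.h = 0 ∧ S'.pd = none ∧ ∀ u, S'.val u = v u

lemma reach_none (D : Dat k) [NeZero s] (S : St k s) (h : S.pd = none) :
    ∃ S', Reach D S S' ∧ Fix S' S.c S.ph S.val := by
  refine ⟨_, reach_rot D (-S.h).val S h, rfl, rfl, ?_, h, ?_⟩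
  · simp
  · intro u
    simp [St.val, pv, h]

lemma reach_some (D : Dat k) [NeZero s] (u : Bool) (n : ℕ) : ∀ (S : St k s), s - S.h.val = n →
    S.pd = some u → 0 ≤ S.val u → ∃ S', Reach D S S' ∧ Fix S' S.c S.ph S.val := by
  induction n using Nat.strong_induction_on with
  | _ n ih =>
    intro S hn h1 h2
    by_cases hb : S.β u S.h = true
    · obtain ⟨S', r, f1, f2, f3, f4, f5⟩ := reach_none D { S with
        h := S.h + 1, pd := none, β := Function.update S.β u (Function.update (S.β u) S.h false) } rfl
      refine ⟨S', (Reach.step (step_d0 _ _ h1 hb)).trans r, f1, f2, f3, f4, fun v => ?_⟩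
      rw [f5, val_d0 h1 hb]
    · have hb : S.β u S.h = false := by simpa using hb
      by_cases h3 : S.h + 1 = 0
      · exfalso
        have := bv_last h3 hb
        simp [St.val, pv, h1] at h2
        linarith
      · have hlt := ZMod.val_lt S.h
        have hsu := val_succ h3
        obtain ⟨S', r, f1, f2, f3, f4, f5⟩ := ih (s - (S.h + 1).val) (by omega) { S with
          h := S.h + 1, β := Function.update S.β u (Function.update (S.β u) S.h true) } rfl h1
          (by rw [val_d1 h1 hb h3]; exact h2)
        refine ⟨S', (Reach.step (step_d1 _ _ h1 hb h3)).trans r, f1, f2, f3, f4, fun v => ?_⟩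
        rw [f5, val_d1 h1 hb h3]

lemma reach_read (D : Dat k) [NeZero s] (S : St k s) {hold b : Bool} {ph' : Fin 4}
    (h1 : S.pd = none) (h2 : S.h = 0) (h3 : phs hold b S.ph = some ph')
    (h4 : b = false → ∀ t, (S.c t).val ≠ hold.toNat) (h5 : 1 ≤ S.val b) :
    ∃ S', Reach D S S' ∧ Fix S' (fun t => mvm hold (S.c t)) ph'
      (fun u => S.val u - if b = u then 1 else 0) := by
  obtain ⟨S', r, f1, f2, f3, f4, f5⟩ := reach_some D b _
    { S with c := fun t => mvm hold (S.c t), ph := ph', pd := some b } rfl rfl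
    (by rw [val_rd h1 h2]; simp; exact h5)
  refine ⟨S', (Reach.step (step_rd _ _ h1 h2 h3 h4)).trans r, f1, f2, f3, f4, fun v => ?_⟩
  rw [f5, val_rd h1 h2]

def fph (hold : Bool) : Fin 4 → List Bool → Option (Fin 4)
  | ph, [] => some ph
  | ph, b :: l => (phs hold b ph).bind fun ph' => fph hold ph' l

lemma fph_pre (a b : ℕ) : fph true 0 (Pre a b) = some 2 := by
  have h1 : ∀ b, fph true 1 (List.replicate b false ++ [true]) = some 2 := by
    intro b
    induction b with
    | zero => simp [fph, phs]
    | succ b ih => rw [List.replicate_succ, List.cons_append, fph]; simpa [phs] using ih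
  induction a with
  | zero =>
    simp only [Pre, List.replicate_zero, List.nil_append]
    rw [List.replicate_succ, List.cons_append, fph]; simpa [phs] using h1 b
  | succ a ih =>
    simp only [Pre] at ih ⊢
    rw [List.replicate_succ, List.cons_append, fph]
    simpa [phs] using ih

lemma fph_three (l : List Bool) : fph false 3 l = some 3 := by
  induction l with
  | nil => rfl
  | cons b l ih => simpa [fph, phs] using ih

lemma fph_two (b : Bool) (l : List Bool) : fph false 2 (b :: l) = some 3 := by
  simpa [fph, phs] using fph_three l

lemma reach_hold (D : Dat k) [NeZero s] (x : Option (Fin k)) (ph' : Fin 4) (p : List (Option (Fin k))) :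
    ∀ (y : List (Option (Fin k))) (S : St k s),
    S.pd = none → S.h = 0 → fph true S.ph (bits p) = some ph' → Rep S.c (x :: (p ++ y)) →
    (∀ u, ((bits p).count u : ℤ) ≤ S.val u) →
    ∃ S', Reach D S S' ∧ Rep S'.c (x :: (y ++ p)) ∧ 
      Fix S' S'.c ph' (fun u => S.val u - (bits p).count u) := by
  induction p with
  | nil =>
    intro y S h1 h2 h3 h4 h5
    have : S.ph = ph' := by simpa [fph, bits] using h3
    exact ⟨S, Reach.refl D S, by simpa using h4, rfl, this, h2, h1, fun u => by simp [bits]⟩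
  | cons e p ih =>
    intro y S h1 h2 h3 h4 h5
    rw [bits_cons, fph, Option.bind_eq_some_iff] at h3
    obtain ⟨ph1, h3, h3'⟩ := h3
    have h6 : 1 ≤ S.val e.isSome := by
      have := h5 e.isSome
      simp only [bits_cons, List.count_cons_self] at this
      push_cast at this
      have : (0 : ℤ) ≤ ((bits p).count e.isSome : ℤ) := by positivity
      linarith
    have h7 : e.isSome = false → ∀ t, (S.c t).val ≠ true.toNat := by
      intro he t ht
      have := (h4.2 t 1).2 ht
      simp at this
      simp [this] at he
    obtain ⟨S1, r1, f1, f2, f3, f4, f5⟩ := reach_read D S h1 h2 h3 h7 h6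
    have h8 : Rep S1.c (x :: (p ++ (y ++ [e]))) := by
      rw [f1]
      simpa [mvm] using rep_hld (by simpa using h4 : Rep S.c (x :: e :: (p ++ y)))
    obtain ⟨S2, r2, g0, g1, g2, g3, g4, g5⟩ := ih (y ++ [e]) S1 f4 f3 (by rw [f2]; exact h3') h8 (by
      intro u
      rw [f5]
      have := h5 u
      rw [bits_cons, List.count_cons] at this
      by_cases he : e.isSome = u <;> simp [he] at this ⊢ <;> linarith)
    refine ⟨S2, r1.trans r2, by simpa using g0, g1, g2, g3, g4, fun u => ?_⟩
    simp only [g5, f5, bits_cons, List.count_cons]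
    by_cases he : e.isSome = u <;> simp [he]
    ring

lemma reach_norm (D : Dat k) [NeZero s] (ph' : Fin 4) (p : List (Option (Fin k))) :
    ∀ (y : List (Option (Fin k))) (S : St k s),
    S.pd = none → S.h = 0 → fph false S.ph (bits p) = some ph' → Rep S.c (p ++ y) →
    (∀ u, ((bits p).count u : ℤ) ≤ S.val u) →
    ∃ S', Reach D S S' ∧ Rep S'.c (y ++ p) ∧ 
      Fix S' S'.c ph' (fun u => S.val u - (bits p).count u) := by
  induction p with
  | nil =>
    intro y S h1 h2 h3 h4 h5
    have : S.ph = ph' := by simpa [fph, bits] using h3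
    exact ⟨S, Reach.refl D S, by simpa using h4, rfl, this, h2, h1, fun u => by simp [bits]⟩
  | cons e p ih =>
    intro y S h1 h2 h3 h4 h5
    rw [bits_cons, fph, Option.bind_eq_some_iff] at h3
    obtain ⟨ph1, h3, h3'⟩ := h3
    have h6 : 1 ≤ S.val e.isSome := by
      have := h5 e.isSome
      simp only [bits_cons, List.count_cons_self] at this
      push_cast at this
      have : (0 : ℤ) ≤ ((bits p).count e.isSome : ℤ) := by positivity
      linarith
    have h7 : e.isSome = false → ∀ t, (S.c t).val ≠ false.toNat := by
      intro he t ht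
      have := (h4.2 t 0).2 ht
      simp at this
      simp [this] at he
    obtain ⟨S1, r1, f1, f2, f3, f4, f5⟩ := reach_read D S h1 h2 h3 h7 h6
    have h8 : Rep S1.c (p ++ (y ++ [e])) := by
      rw [f1]
      simpa [mvm] using rep_nrm (by simpa using h4 : Rep S.c (e :: (p ++ y)))
    obtain ⟨S2, r2, g0, g1, g2, g3, g4, g5⟩ := ih (y ++ [e]) S1 f4 f3 (by rw [f2]; exact h3') h8 (by
      intro u
      rw [f5]
      have := h5 u
      rw [bits_cons, List.count_cons] at this
      by_cases he : e.isSome = u <;> simp [he] at this ⊢ <;> linarith)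
    refine ⟨S2, r1.trans r2, by simpa using g0, g1, g2, g3, g4, fun u => ?_⟩
    simp only [g5, f5, bits_cons, List.count_cons]
    by_cases he : e.isSome = u <;> simp [he]
    ring

lemma reach_pass (D : Dat k) [NeZero s] (hs : k < 2 ^ s) {S : St k s} {l l' : List (Option (Fin k))}
    (h : Good S l) (hm : Mv l l') (hc : (bits l).count false = k) :
    ∃ S', Reach D S S' ∧ Good S' l' := by
  have hv := h.val hs
  obtain ⟨a1, a2, a3, a4, a5⟩ := h
  have hcu : ∀ u, (bits l).count u = k := by
    intro u
    have h1 := count_tf (bits l)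
    rw [bits_length, a5.1] at h1
    cases u <;> omega
  obtain ⟨x, p, q, a, b, rfl, rfl, hp⟩ := hm
  have hcu' : ∀ u, ((bits p).count u : ℤ) + (bits (x :: q)).count u = k := by
    intro u
    have := hcu u
    rw [bits_cons, bits_append, List.count_cons, List.count_append] at this
    rw [bits_cons, List.count_cons]
    rw [← Nat.cast_add, Nat.cast_inj]
    omega
  obtain ⟨S1, r1, f0, f1, f2, f3, f4, f5⟩ := reach_hold D x 2 p q S a1 a2
    (by rw [a3, hp, fph_pre]) a5 (by intro u; rw [hv]; have := hcu' u; omega)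
  obtain ⟨S2, r2, g0, g1, g2, g3, g4, g5⟩ := reach_norm D 3 (x :: q) p S1 f4 f3
    (by rw [f2, bits_cons, fph_two]) (by simpa using f0)
    (by intro u; simp only [f5, hv]; have := hcu' u; omega)
  have hz : ∀ u j, S2.β u j = false := by
    intro u
    apply bv_zero
    have : S2.val u = 0 := by
      simp only [g5, f5, hv]; have := hcu' u; omega
    simpa [St.val, pv, g4] using this
  refine ⟨_, (r1.trans r2).trans (Reach.step (step_fin _ _ g4 g3 g2 hz)), g4, g3, rfl, ?_, g0⟩
  intro u
  rfl

lemma reach_round (D : Dat k) [NeZero s] (hs : k < 2 ^ s) {S : St k s} {w : ℕ}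
    (h : Good S (relbl (D.σ ^ w) (D.L 0))) (ρ : ℕ) (hρ : ρ ≤ D.Z) :
    ∃ S', Reach D S S' ∧ Good S' (relbl (D.σ ^ w) (D.L ρ)) := by
  induction ρ with
  | zero => exact ⟨S, Reach.refl D S, h⟩
  | succ ρ ih =>
    obtain ⟨S1, r1, g1⟩ := ih (by omega)
    obtain ⟨S2, r2, g2⟩ := reach_pass D hs g1 ((D.mv ρ (by omega)).relbl _)
      (by rw [bits_relbl, D.cnt _ (by omega)])
    exact ⟨S2, r1.trans r2, g2⟩

lemma reach_rounds (D : Dat k) [NeZero s] (hs : k < 2 ^ s) {S : St k s}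
    (h : Good S (D.L 0)) (w : ℕ) :
    ∃ S', Reach D S S' ∧ Good S' (relbl (D.σ ^ w) (D.L 0)) := by
  induction w with
  | zero =>
    refine ⟨S, Reach.refl D S, ?_⟩
    have : relbl (D.σ ^ 0) (D.L 0) = D.L 0 := by simp [relbl]
    rwa [this]
  | succ w ih =>
    obtain ⟨S1, r1, g1⟩ := ih
    obtain ⟨S2, r2, a1, a2, a3, a4, a5⟩ := reach_round D hs g1 D.Z le_rfl
    obtain ⟨c', b1, b2⟩ := D.wrap_rep a5
    refine ⟨_, (r1.trans r2).trans (Reach.step (step_wrap _ _ a1 a2 a3 (fun u j => by rw [a4]) b1)), ?_⟩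
    exact ⟨a1, a2, a3, a4, b2⟩

lemma exists_dat (hk : 1 ≤ k) (σ : Equiv.Perm (Fin k)) : ∃ D : Dat k, D.σ = σ := by
  obtain ⟨L, h1, h2⟩ := exists_chain hk
  have hN : 2 ≤ Nat.choose (2 * k) k := by
    have := Nat.two_dvd_centralBinom_of_one_le hk
    exact Nat.le_of_dvd (Nat.centralBinom_pos k) this
  obtain ⟨c0, h0⟩ := (h2 0 (by omega)).2.2.2
  obtain ⟨cZ, hZ⟩ := (h2 (Nat.choose (2 * k) k - 2) (by omega)).2.2.2
  exact ⟨⟨L, Nat.choose (2 * k) k - 2, c0, cZ, σ, hk, by omega, fun i hi => h1 i (by omega),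
    fun i hi => (h2 i (by omega)).1, fun i hi => (h2 i (by omega)).2.1,
    fun i hi => (h2 i (by omega)).2.2.1, h0, hZ⟩, rfl⟩

lemma exists_landau (k : ℕ) : ∃ σ : Equiv.Perm (Fin k), orderOf σ = landau k := by
  obtain ⟨σ, _, h⟩ := Finset.exists_mem_eq_sup (Finset.univ : Finset (Equiv.Perm (Fin k)))
    Finset.univ_nonempty (fun σ => orderOf σ)
  exact ⟨σ, h.symm⟩

lemma machine_big (hk : 2 ≤ k) [NeZero s] (hs : k < 2 ^ s) :
    ∃ (ac : Ltr → P k s → Option (P k s)), Function.Injective ac ∧ ∃ w0 : List Ltr, w0 ≠ [] ∧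
      ∀ w : List Ltr, w ≠ [] → run ac w = run ac w0 →
        Nat.choose (2 * k) k * landau k ≤ w.length := by
  obtain ⟨σ, hσ⟩ := exists_landau k
  obtain ⟨D, hD⟩ := exists_dat (by omega : 1 ≤ k) σ
  obtain ⟨n, hn⟩ : ∃ n, orderOf D.σ = n + 1 := ⟨orderOf D.σ - 1, by
    have := orderOf_pos D.σ; omega⟩
  let S : St k s := ⟨D.c0, 0, 0, none, fun _ => Kb k s⟩
  have hS : Good S (D.L 0) := ⟨rfl, rfl, rfl, fun _ => rfl, D.r0⟩
  obtain ⟨S1, r1, g1⟩ := reach_rounds D hs hS n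
  obtain ⟨T, r2, g2⟩ := reach_round D hs g1 D.Z le_rfl
  obtain ⟨w0, hw0⟩ := r1.trans r2
  have hlow : ∀ w, run (act (Kb k s) D.Wm) w = run (act (Kb k s) D.Wm) w0 →
      Nat.choose (2 * k) k * landau k ≤ w.length := by
    intro w hw
    have := lower D hs w hS hn g2 (by rw [hw]; exact hw0)
    rw [← hσ, ← hD, hn, D.hN]
    have h6 : 6 ≤ D.Z + 2 := by
      rw [← D.hN]
      have h1 : Nat.choose (2 * k) 2 ≤ Nat.choose (2 * k) k := by
        have := Nat.choose_le_centralBinom 2 k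
        exact this
      have h2 : Nat.choose 4 2 ≤ Nat.choose (2 * k) 2 := Nat.choose_le_choose 2 (by omega)
      exact le_trans h2 h1
    refine le_trans ?_ this
    obtain ⟨z, hz⟩ : ∃ z, D.Z = z + 4 := ⟨D.Z - 4, by omega⟩
    rw [hz]
    nlinarith [Nat.zero_le (n * z)]
  refine ⟨act (Kb k s) D.Wm, act_inj _ _, w0, ?_, fun w _ h => hlow w h⟩
  rintro rfl
  have := hlow [] rfl
  rw [← hσ, ← hD, hn, D.hN] at this
  simp at this

lemma machine_one [NeZero s] :
    ∃ (ac : Ltr → P 1 s → Option (P 1 s)), Function.Injective ac ∧ ∃ w0 : List Ltr, w0 ≠ [] ∧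
      ∀ w : List Ltr, w ≠ [] → run ac w = run ac w0 →
        Nat.choose (2 * 1) 1 * landau 1 ≤ w.length := by
  have hl : landau 1 = 1 := by
    obtain ⟨σ, hσ⟩ := exists_landau 1
    rw [← hσ, Subsingleton.elim σ 1, orderOf_one]
  refine ⟨act (fun _ => false) (fun _ => none), act_inj _ _, [.rot, .fin], by simp, ?_⟩
  intro w hw h
  rw [hl]
  show 2 ≤ w.length
  rcases w with _ | ⟨l, _ | ⟨l', w⟩⟩
  · exact absurd rfl hw
  · exfalso
    have := congrFun h (.dum l)
    simp only [run, act_dum] at this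
    cases l <;> simp [act_dum] at this
  · simp

end
end Depth

/-- There exist constants `m` and `C` such that for every `k ≥ 1` there are
`n ≤ 2k + C·(log₂(2k + 1) + 1)` and a set `G` of `m` matrices in
`Matrix (Fin n) (Fin n) ℕ` with entries in `{0, 1}`, such that the multiplicative semigroup
generated by `G` is finite and some element of it has depth at least
`(2k choose k) · g(k)` with respect to `G`, where `g` is the Landau function. -/
theorem matrix_semigroup_depth_constant_alphabet :
    ∃ m C : ℕ, ∀ k : ℕ, 1 ≤ k →
      ∃ n : ℕ, n ≤ 2 * k + C * (Nat.log 2 (2 * k + 1) + 1) ∧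
        ∃ G : Finset (Matrix (Fin n) (Fin n) ℕ),
          G.card = m ∧
          (∀ M ∈ G, ∀ p q, M p q = 0 ∨ M p q = 1) ∧
          {M : Matrix (Fin n) (Fin n) ℕ |
            ∃ w : List (Matrix (Fin n) (Fin n) ℕ),
              w ≠ [] ∧ (∀ X ∈ w, X ∈ G) ∧ w.prod = M}.Finite ∧
          ∃ M : Matrix (Fin n) (Fin n) ℕ,
            (∃ w : List (Matrix (Fin n) (Fin n) ℕ),
              w ≠ [] ∧ (∀ X ∈ w, X ∈ G) ∧ w.prod = M) ∧
            (∀ w : List (Matrix (Fin n) (Fin n) ℕ),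
              w ≠ [] → (∀ X ∈ w, X ∈ G) → w.prod = M →
                Nat.choose (2 * k) k * landau k ≤ w.length) := by
  refine ⟨Fintype.card Depth.Ltr, Fintype.card Depth.Ltr + 12, fun k hk => ?_⟩
  have : NeZero (Nat.log 2 (2 * k + 1) + 1) := ⟨by omega⟩
  have hs : k < 2 ^ (Nat.log 2 (2 * k + 1) + 1) :=
    lt_of_le_of_lt (by omega) (Nat.lt_pow_succ_log_self (by norm_num) (2 * k + 1))
  have key : ∃ (ac : Depth.Ltr → Depth.P k (Nat.log 2 (2 * k + 1) + 1) →
        Option (Depth.P k (Nat.log 2 (2 * k + 1) + 1))), Function.Injective ac ∧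
      ∃ w0 : List Depth.Ltr, w0 ≠ [] ∧
      ∀ w : List Depth.Ltr, w ≠ [] → Depth.run ac w = Depth.run ac w0 →
        Nat.choose (2 * k) k * landau k ≤ w.length := by
    rcases Nat.lt_or_ge k 2 with h | h
    · obtain rfl : k = 1 := by omega
      exact Depth.machine_one
    · exact Depth.machine_big h hs
  obtain ⟨ac, h1, w0, h2, h3⟩ := key
  refine ⟨_, ?_, Depth.framework ac h1 _ w0 h2 h3⟩
  rw [Depth.card_P]
  generalize Nat.log 2 (2 * k + 1) = t
  generalize Fintype.card Depth.Ltr = m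
  nlinarith [Nat.zero_le (m * t), Nat.zero_le t]
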